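/- arXiv:2206.07688 — 3 statements merged into one kernel-verified Lean document; each statement's English description precedes it below -/
import Mathlib

section
/- For every summable weighted graph (G,m), the spectral gap of the normalised Laplacian satisfies 1 − √(1 − h(G,m)²) ≤ λ_gap(Δ). (Here h(G,m) ∈ [0,1], so the square root is real.) -/
open MeasureTheory

/-- A summable weighted graph on a vertex set `V`. -/
structure SummableWeightedGraph (V : Type*) where
  m : V → V → ℝ
  symm : ∀ u v, m u v = m v u
  nonneg : ∀ u v, 0 ≤ m u v
  loopless : ∀ v, m v v = 0
  summable : Summable fun p : V × V => m p.1 p.2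
  noIsolated : ∀ v, 0 < ∑' u, m v u

namespace SummableWeightedGraph

variable {V : Type*} (G : SummableWeightedGraph V)

/-- The weight of a vertex. -/
noncomputable def deg (v : V) : ℝ := ∑' u, G.m v u

/-- The weight of a set of vertices. -/
noncomputable def setWeight (S : Set V) : ℝ := ∑' v : S, G.deg v

/-- The weight of the boundary of a set of vertices. -/
noncomputable def boundaryWeight (S : Set V) : ℝ :=
  ∑' p : ↥S × ↥Sᶜ, G.m p.1 p.2

/-- The Cheeger constant. -/
noncomputable def cheegerConst : ℝ :=
  sInf { r : ℝ | ∃ S : Set V, S.Nonempty ∧ G.setWeight S ≤ G.setWeight Sᶜ ∧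
    r = G.boundaryWeight S / G.setWeight S }

/-- The weighted counting measure on vertices. -/
noncomputable def measure [MeasurableSpace V] : Measure V :=
  Measure.sum fun v => ENNReal.ofReal (G.deg v) • Measure.dirac v

/-- The normalised Laplacian, characterised by its pointwise formula. -/
def IsLaplacian [MeasurableSpace V]
    (L : Lp ℝ 2 G.measure →L[ℝ] Lp ℝ 2 G.measure) : Prop :=
  ∀ f : Lp ℝ 2 G.measure, ∀ᵐ v ∂G.measure,
    L f v = f v - (G.deg v)⁻¹ * ∑' u, G.m v u * f u

end SummableWeightedGraph
namespace SummableWeightedGraph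
variable {V : Type*} (G : SummableWeightedGraph V)

lemma deg_pos (v : V) : 0 < G.deg v := G.noIsolated v

lemma row_summable (v : V) : Summable (fun u => G.m v u) :=
  G.summable.prod_factor v

lemma deg_summable : Summable G.deg := G.summable.prod

def L2 (f : V → ℝ) : Prop := Summable fun v => G.deg v * f v ^ 2

lemma fst_summable {w : V → ℝ} (h0 : ∀ v, 0 ≤ w v) (hw : Summable fun v => G.deg v * w v) :
    Summable (fun p : V × V => G.m p.1 p.2 * w p.1) := by
  rw [summable_prod_of_nonneg (f := fun p : V × V => G.m p.1 p.2 * w p.1) (fun p => mul_nonneg (G.nonneg _ _) (h0 _))]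
  refine ⟨fun v => (G.row_summable v).mul_right (w v), ?_⟩
  refine hw.congr (fun v => ?_)
  exact (tsum_mul_right (f := fun u => G.m v u) (a := w v)).symm

lemma fst_tsum {w : V → ℝ} (hs : Summable (fun p : V × V => G.m p.1 p.2 * w p.1)) :
    ∑' p : V × V, G.m p.1 p.2 * w p.1 = ∑' v, G.deg v * w v := by
  rw [hs.tsum_prod]
  simp only [tsum_mul_right]
  rfl

lemma swap_summable {F : V × V → ℝ} (h : Summable (fun p : V × V => G.m p.1 p.2 * F p)) :
    Summable (fun p : V × V => G.m p.1 p.2 * F p.swap) := by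
  have := (Equiv.prodComm V V).summable_iff.mpr h
  refine this.congr (fun p => ?_)
  simp [G.symm p.1 p.2]

lemma swap_tsum (F : V × V → ℝ) :
    ∑' p : V × V, G.m p.1 p.2 * F p.swap = ∑' p : V × V, G.m p.1 p.2 * F p := by
  rw [← (Equiv.prodComm V V).tsum_eq]
  refine tsum_congr (fun p => ?_)
  simp [G.symm p.1 p.2]

variable {G}

lemma L2.fst {f : V → ℝ} (hf : G.L2 f) : Summable (fun p : V × V => G.m p.1 p.2 * f p.1 ^ 2) :=
  G.fst_summable (w := fun v => f v ^ 2) (fun _ => sq_nonneg _) hf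

lemma L2.snd {f : V → ℝ} (hf : G.L2 f) : Summable (fun p : V × V => G.m p.1 p.2 * f p.2 ^ 2) :=
  G.swap_summable (F := fun p => f p.1 ^ 2) hf.fst

lemma summable_mul_of_sq {ι : Type*} {c a b : ι → ℝ} (hc : ∀ i, 0 ≤ c i)
    (ha : Summable fun i => c i * a i ^ 2) (hb : Summable fun i => c i * b i ^ 2) :
    Summable fun i => c i * (a i * b i) := by
  refine Summable.of_norm_bounded (ha.add hb) (fun i => ?_)
  rw [Real.norm_eq_abs, abs_mul, abs_of_nonneg (hc i), ← mul_add]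
  refine mul_le_mul_of_nonneg_left ?_ (hc i)
  rw [abs_le]
  constructor <;> nlinarith [sq_nonneg (a i + b i), sq_nonneg (a i - b i)]

lemma L2.const (c : ℝ) : G.L2 (fun _ => c) := G.deg_summable.mul_right _

lemma L2.sub_const {f : V → ℝ} (hf : G.L2 f) (c : ℝ) : G.L2 (fun v => f v - c) := by
  have h1 := summable_mul_of_sq (fun v => (G.deg_pos v).le) hf (L2.const c)
  refine ((hf.add (L2.const (G := G) c)).sub (h1.mul_left 2)).congr (fun v => ?_)
  ring

lemma L2.mono {f g : V → ℝ} (hf : G.L2 f) (h : ∀ v, g v ^ 2 ≤ f v ^ 2) : G.L2 g :=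
  Summable.of_nonneg_of_le (fun v => mul_nonneg (G.deg_pos v).le (sq_nonneg _))
    (fun v => mul_le_mul_of_nonneg_left (h v) (G.deg_pos v).le) hf

variable (G) in
/-- twice the Dirichlet form -/
noncomputable def D (f g : V → ℝ) : ℝ :=
  ∑' p : V × V, G.m p.1 p.2 * ((f p.1 - f p.2) * (g p.1 - g p.2))

lemma L2.s11 {f g : V → ℝ} (hf : G.L2 f) (hg : G.L2 g) :
    Summable (fun p : V × V => G.m p.1 p.2 * (f p.1 * g p.1)) :=
  summable_mul_of_sq (fun _ => G.nonneg _ _) hf.fst hg.fst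
lemma L2.s12 {f g : V → ℝ} (hf : G.L2 f) (hg : G.L2 g) :
    Summable (fun p : V × V => G.m p.1 p.2 * (f p.1 * g p.2)) :=
  summable_mul_of_sq (fun _ => G.nonneg _ _) hf.fst hg.snd
lemma L2.s21 {f g : V → ℝ} (hf : G.L2 f) (hg : G.L2 g) :
    Summable (fun p : V × V => G.m p.1 p.2 * (f p.2 * g p.1)) :=
  summable_mul_of_sq (fun _ => G.nonneg _ _) hf.snd hg.fst
lemma L2.s22 {f g : V → ℝ} (hf : G.L2 f) (hg : G.L2 g) :
    Summable (fun p : V × V => G.m p.1 p.2 * (f p.2 * g p.2)) :=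
  summable_mul_of_sq (fun _ => G.nonneg _ _) hf.snd hg.snd

lemma L2.sD {f g : V → ℝ} (hf : G.L2 f) (hg : G.L2 g) :
    Summable (fun p : V × V => G.m p.1 p.2 * ((f p.1 - f p.2) * (g p.1 - g p.2))) := by
  refine ((((hf.s11 hg).sub (hf.s12 hg)).sub (hf.s21 hg)).add (hf.s22 hg)).congr (fun p => ?_)
  ring

lemma L2.D_eq {f g : V → ℝ} (hf : G.L2 f) (hg : G.L2 g) :
    G.D f g = 2 * ∑' v, G.deg v * ((f v - (G.deg v)⁻¹ * ∑' u, G.m v u * f u) * g v) := by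
  have e1 : G.D f g = 2 * (∑' p : V × V, G.m p.1 p.2 * (f p.1 * g p.1)
      - ∑' p : V × V, G.m p.1 p.2 * (f p.2 * g p.1)) := by
    have h22 := G.swap_tsum (fun p => f p.1 * g p.1)
    have h12 := G.swap_tsum (fun p => f p.2 * g p.1)
    simp only [Prod.fst_swap, Prod.snd_swap] at h22 h12
    have : G.D f g = ((∑' p : V × V, G.m p.1 p.2 * (f p.1 * g p.1)
      - ∑' p : V × V, G.m p.1 p.2 * (f p.1 * g p.2))
      - ∑' p : V × V, G.m p.1 p.2 * (f p.2 * g p.1))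
      + ∑' p : V × V, G.m p.1 p.2 * (f p.2 * g p.2) := by
      rw [← (hf.s11 hg).tsum_sub (hf.s12 hg),
        ← ((hf.s11 hg).sub (hf.s12 hg)).tsum_sub (hf.s21 hg),
        ← (((hf.s11 hg).sub (hf.s12 hg)).sub (hf.s21 hg)).tsum_add (hf.s22 hg)]
      exact tsum_congr (fun p => by ring)
    rw [this, h22, h12]; ring
  rw [e1]
  congr 1
  rw [← (hf.s11 hg).tsum_sub (hf.s21 hg), ((hf.s11 hg).sub (hf.s21 hg)).tsum_prod]
  refine tsum_congr (fun v => ?_)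
  have hA : Summable (fun u => G.m v u * f u) := by
    have := (hf.s21 (L2.const (G := G) 1)).prod_factor v
    simpa using this
  have : ∀ u, G.m v u * (f v * g v) - G.m v u * (f u * g v)
      = G.m v u * (f v * g v) - (G.m v u * f u) * g v := fun u => by ring
  simp only [this]
  rw [((G.row_summable v).mul_right _).tsum_sub (hA.mul_right _), tsum_mul_right, tsum_mul_right]
  have := (G.deg_pos v).ne'
  change G.deg v * _ - _ = _
  field_simp

lemma D_comm (f g : V → ℝ) : G.D f g = G.D g f :=
  tsum_congr (fun p => by ring)

lemma D_const_right (f : V → ℝ) (c : ℝ) : G.D f (fun _ => c) = 0 := by simp [D]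

lemma D_nonneg (f : V → ℝ) : 0 ≤ G.D f f :=
  tsum_nonneg (fun _ => mul_nonneg (G.nonneg _ _) (mul_self_nonneg _))

end SummableWeightedGraph
namespace SummableWeightedGraph
variable {V : Type*} {G : SummableWeightedGraph V}
open scoped ENNReal

lemma setWeight_nonneg (S : Set V) : 0 ≤ G.setWeight S := tsum_nonneg (fun v => (G.deg_pos v).le)

lemma boundaryWeight_nonneg (S : Set V) : 0 ≤ G.boundaryWeight S :=
  tsum_nonneg (fun _ => G.nonneg _ _)

lemma setWeight_pos {S : Set V} (h : S.Nonempty) : 0 < G.setWeight S := by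
  obtain ⟨v, hv⟩ := h
  exact (G.deg_summable.subtype S).tsum_pos (fun v => (G.deg_pos v.1).le) ⟨v, hv⟩ (G.deg_pos v)

lemma cheeger_bdd : BddBelow { r : ℝ | ∃ S : Set V, S.Nonempty ∧ G.setWeight S ≤ G.setWeight Sᶜ ∧
    r = G.boundaryWeight S / G.setWeight S } := by
  refine ⟨0, ?_⟩
  rintro r ⟨S, -, -, rfl⟩
  exact div_nonneg (boundaryWeight_nonneg _) (setWeight_nonneg _)

lemma cheeger_nonneg : 0 ≤ G.cheegerConst := by
  refine Real.sInf_nonneg ?_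
  rintro r ⟨S, -, -, rfl⟩
  exact div_nonneg (boundaryWeight_nonneg _) (setWeight_nonneg _)

lemma cheeger_mul_le {S : Set V} (h : G.setWeight S ≤ G.setWeight Sᶜ) :
    G.cheegerConst * G.setWeight S ≤ G.boundaryWeight S := by
  rcases S.eq_empty_or_nonempty with rfl | hS
  · simp only [setWeight, tsum_empty, mul_zero]
    exact boundaryWeight_nonneg _
  · rw [← le_div_iff₀ (setWeight_pos hS)]
    exact csInf_le cheeger_bdd ⟨S, hS, h, rfl⟩

lemma ofReal_setWeight (S : Set V) :
    ENNReal.ofReal (G.setWeight S) = ∑' v, S.indicator (fun v => ENNReal.ofReal (G.deg v)) v := by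
  rw [setWeight, ENNReal.ofReal_tsum_of_nonneg (fun v : S => (G.deg_pos v.1).le)
    (G.deg_summable.subtype S), tsum_subtype S (fun v => ENNReal.ofReal (G.deg v))]

lemma ofReal_boundaryWeight (S : Set V) :
    ENNReal.ofReal (G.boundaryWeight S) =
      ∑' p : V × V, (S ×ˢ Sᶜ).indicator (fun p => ENNReal.ofReal (G.m p.1 p.2)) p := by
  have hinj : Function.Injective (fun p : ↥S × ↥Sᶜ => ((p.1 : V), (p.2 : V))) := by
    rintro ⟨a, b⟩ ⟨c, d⟩ h
    simp only [Prod.mk.injEq] at h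
    exact Prod.ext (Subtype.ext h.1) (Subtype.ext h.2)
  have hs := G.summable.comp_injective hinj
  rw [boundaryWeight, ENNReal.ofReal_tsum_of_nonneg (fun p => G.nonneg _ _) hs]
  rw [← hinj.tsum_eq]
  · refine tsum_congr (fun p => ?_)
    rw [Set.indicator_of_mem]
    exact ⟨p.1.2, p.2.2⟩
  · intro p hp
    have := Set.mem_of_indicator_ne_zero hp
    exact ⟨(⟨p.1, this.1⟩, ⟨p.2, this.2⟩), rfl⟩

lemma ofReal_sub_eq (a b : ℝ) :
    ENNReal.ofReal (a - b) = ∫⁻ s : ℝ, (Set.Ico b a).indicator 1 s := by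
  rw [lintegral_indicator_one measurableSet_Ico, Real.volume_Ico]

lemma coarea [Countable V] {w : V → ℝ} (h0 : ∀ v, 0 ≤ w v)
    (hw : Summable fun v => G.deg v * w v)
    (hS : ∀ s : ℝ, 0 ≤ s → G.setWeight {v | s < w v} ≤ G.setWeight {v | s < w v}ᶜ) :
    G.cheegerConst * ∑' v, G.deg v * w v ≤ ∑' p : V × V, G.m p.1 p.2 * max (w p.1 - w p.2) 0 := by
  have hsum : Summable (fun p : V × V => G.m p.1 p.2 * max (w p.1 - w p.2) 0) := by
    refine Summable.of_nonneg_of_le (fun p => mul_nonneg (G.nonneg _ _) (le_max_right _ _))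
      (fun p => mul_le_mul_of_nonneg_left ?_ (G.nonneg _ _)) (G.fst_summable h0 hw)
    exact max_le (by linarith [h0 p.2]) (h0 _)
  have hnn : 0 ≤ ∑' p : V × V, G.m p.1 p.2 * max (w p.1 - w p.2) 0 :=
    tsum_nonneg (fun p => mul_nonneg (G.nonneg _ _) (le_max_right _ _))
  rw [← ENNReal.ofReal_le_ofReal_iff hnn, ENNReal.ofReal_mul cheeger_nonneg,
    ENNReal.ofReal_tsum_of_nonneg (fun v => mul_nonneg (G.deg_pos v).le (h0 v)) hw,
    ENNReal.ofReal_tsum_of_nonneg (fun p => mul_nonneg (G.nonneg _ _) (le_max_right _ _)) hsum]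
  have e1 : ∀ v, ENNReal.ofReal (G.deg v * w v)
      = ∫⁻ s : ℝ, ENNReal.ofReal (G.deg v) * (Set.Ico 0 (w v)).indicator 1 s := by
    intro v
    rw [lintegral_const_mul _ (measurable_one.indicator measurableSet_Ico), ← ofReal_sub_eq, sub_zero,
      ENNReal.ofReal_mul (G.deg_pos v).le]
  have e2 : ∀ p : V × V, ENNReal.ofReal (G.m p.1 p.2 * max (w p.1 - w p.2) 0)
      = ∫⁻ s : ℝ, ENNReal.ofReal (G.m p.1 p.2) * (Set.Ico (w p.2) (w p.1)).indicator 1 s := by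
    intro p
    rw [lintegral_const_mul _ (measurable_one.indicator measurableSet_Ico), ← ofReal_sub_eq,
      ENNReal.ofReal_mul (G.nonneg _ _)]
    congr 1
    rw [ENNReal.ofReal_max]; simp
  simp only [e1, e2]
  rw [← lintegral_tsum (fun v =>
      ((measurable_one.indicator measurableSet_Ico).const_mul _).aemeasurable),
    ← lintegral_tsum (fun v =>
      ((measurable_one.indicator measurableSet_Ico).const_mul _).aemeasurable),
    ← lintegral_const_mul' _ _ ENNReal.ofReal_ne_top]
  refine lintegral_mono (fun s => ?_)
  by_cases hs : 0 ≤ s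
  · have h1 := ENNReal.ofReal_le_ofReal (cheeger_mul_le (hS s hs))
    rw [ENNReal.ofReal_mul cheeger_nonneg, ofReal_setWeight, ofReal_boundaryWeight] at h1
    have i1 : ∀ v, ENNReal.ofReal (G.deg v) * (Set.Ico 0 (w v)).indicator 1 s
        = {v | s < w v}.indicator (fun v => ENNReal.ofReal (G.deg v)) v := by
      intro v
      by_cases hv : s < w v
      · simp [Set.indicator, hs, hv]
      · simp [Set.indicator, hv]
    have i2 : ∀ p : V × V, ENNReal.ofReal (G.m p.1 p.2) * (Set.Ico (w p.2) (w p.1)).indicator 1 s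
        = ({v | s < w v} ×ˢ {v | s < w v}ᶜ).indicator (fun p => ENNReal.ofReal (G.m p.1 p.2)) p := by
      intro p
      by_cases hv : s < w p.1 <;> by_cases hu : w p.2 ≤ s <;>
      simp [Set.indicator, hu, hv]
    simpa only [i1, i2] using h1
  · have : ∀ v, (Set.Ico 0 (w v)).indicator (1 : ℝ → ℝ≥0∞) s = 0 := fun v => by
      simp [Set.indicator, hs]
    simp [this]

lemma key [Countable V] {g : V → ℝ} (h0 : ∀ v, 0 ≤ g v) (hg : G.L2 g)
    (hS : G.setWeight {v | 0 < g v} ≤ G.setWeight {v | 0 < g v}ᶜ) :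
    2 * (1 - Real.sqrt (1 - G.cheegerConst ^ 2)) * ∑' v, G.deg v * g v ^ 2 ≤ G.D g g := by
  set N := ∑' v, G.deg v * g v ^ 2 with hN
  have hmono : ∀ {S T : Set V}, S ⊆ T → G.setWeight S ≤ G.setWeight T := by
    intro S T h
    rw [← ENNReal.ofReal_le_ofReal_iff (setWeight_nonneg _), ofReal_setWeight, ofReal_setWeight]
    exact ENNReal.tsum_le_tsum (fun v => Set.indicator_le_indicator_of_subset h (fun _ => zero_le) v)
  have hco := coarea (G := G) (w := fun v => g v ^ 2) (fun v => sq_nonneg _) hg (by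
    intro s hs
    have hsub : {v | s < g v ^ 2} ⊆ {v | 0 < g v} := by
      intro v hv
      have hv' : s < g v ^ 2 := hv
      rcases (h0 v).lt_or_eq with h | h
      · exact h
      · rw [← h] at hv'; norm_num at hv'; linarith
    exact (hmono hsub).trans (hS.trans (hmono (Set.compl_subset_compl.mpr hsub))))
  rw [← hN] at hco
  set h := G.cheegerConst
  set B := ∑' p : V × V, G.m p.1 p.2 * max (g p.1 ^ 2 - g p.2 ^ 2) 0 with hB
  have hBs : Summable (fun p : V × V => G.m p.1 p.2 * max (g p.1 ^ 2 - g p.2 ^ 2) 0) := by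
    refine Summable.of_nonneg_of_le (fun p => mul_nonneg (G.nonneg _ _) (le_max_right _ _))
      (fun p => mul_le_mul_of_nonneg_left ?_ (G.nonneg _ _)) hg.fst
    exact max_le (by nlinarith) (sq_nonneg _)
  have hBs2 := G.swap_summable (F := fun p => max (g p.1 ^ 2 - g p.2 ^ 2) 0) hBs
  have hB2 := G.swap_tsum (fun p => max (g p.1 ^ 2 - g p.2 ^ 2) 0)
  simp only [Prod.fst_swap, Prod.snd_swap] at hBs2 hB2
  rw [← hB] at hB2
  set X := G.D g g with hX
  have hXs := hg.sD hg
  have hN1 : ∑' p : V × V, G.m p.1 p.2 * g p.1 ^ 2 = N := G.fst_tsum (w := fun v => g v ^ 2) hg.fst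
  have hN2 : ∑' p : V × V, G.m p.1 p.2 * g p.2 ^ 2 = N := by
    rw [← hN1]; exact G.swap_tsum (fun p => g p.1 ^ 2)
  have hN0 : 0 ≤ N := tsum_nonneg (fun v => mul_nonneg (G.deg_pos v).le (sq_nonneg _))
  have hquad : ∀ t : ℝ, 0 ≤ X * (t * t) + (- (4 * B)) * t + (4 * N - X) := by
    intro t
    have hYs := ((hg.fst.add hg.snd).mul_left 2).sub hXs
    have hY : ∑' p : V × V, (2 * (G.m p.1 p.2 * g p.1 ^ 2 + G.m p.1 p.2 * g p.2 ^ 2)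
        - G.m p.1 p.2 * ((g p.1 - g p.2) * (g p.1 - g p.2))) = 4 * N - X := by
      rw [((hg.fst.add hg.snd).mul_left 2).tsum_sub hXs, tsum_mul_left, hg.fst.tsum_add hg.snd,
        hN1, hN2, hX, D]
      ring
    have e : X * (t * t) + (- (4 * B)) * t + (4 * N - X) =
      ∑' p : V × V, (((t * t) * (G.m p.1 p.2 * ((g p.1 - g p.2) * (g p.1 - g p.2)))
        - (2 * t) * (G.m p.1 p.2 * max (g p.1 ^ 2 - g p.2 ^ 2) 0
          + G.m p.1 p.2 * max (g p.2 ^ 2 - g p.1 ^ 2) 0))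
        + (2 * (G.m p.1 p.2 * g p.1 ^ 2 + G.m p.1 p.2 * g p.2 ^ 2)
        - G.m p.1 p.2 * ((g p.1 - g p.2) * (g p.1 - g p.2)))) := by
      rw [((hXs.mul_left _).sub ((hBs.add hBs2).mul_left _)).tsum_add hYs,
        (hXs.mul_left _).tsum_sub ((hBs.add hBs2).mul_left _), tsum_mul_left, tsum_mul_left,
        hBs.tsum_add hBs2, hY, hB2, ← hB, hX, D]
      ring
    rw [e]
    refine tsum_nonneg (fun p => ?_)
    have hm := G.nonneg p.1 p.2
    have h1 := h0 p.1
    have h2 := h0 p.2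
    rcases le_total (g p.1) (g p.2) with hle | hle
    · have a1 : g p.1 ^ 2 - g p.2 ^ 2 ≤ 0 := by nlinarith
      have a2 : 0 ≤ g p.2 ^ 2 - g p.1 ^ 2 := by linarith
      rw [max_eq_right a1, max_eq_left a2]
      have := mul_nonneg hm (sq_nonneg (t * (g p.2 - g p.1) - (g p.1 + g p.2)))
      nlinarith
    · have a1 : g p.2 ^ 2 - g p.1 ^ 2 ≤ 0 := by nlinarith
      have a2 : 0 ≤ g p.1 ^ 2 - g p.2 ^ 2 := by linarith
      rw [max_eq_right a1, max_eq_left a2]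
      have := mul_nonneg hm (sq_nonneg (t * (g p.1 - g p.2) - (g p.1 + g p.2)))
      nlinarith
  have hd := discrim_le_zero hquad
  rw [discrim] at hd
  have hh : 0 ≤ h := cheeger_nonneg
  have hhN : 0 ≤ h * N := mul_nonneg hh hN0
  have hBsq : (h * N) ^ 2 ≤ B ^ 2 := pow_le_pow_left₀ hhN hco 2
  have hfin : (2 * N - X) ^ 2 ≤ (2 * N) ^ 2 * (1 - h ^ 2) := by nlinarith
  have h3 : 2 * N - X ≤ Real.sqrt ((2 * N) ^ 2 * (1 - h ^ 2)) := Real.le_sqrt_of_sq_le hfin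
  rw [Real.sqrt_mul (sq_nonneg _), Real.sqrt_sq (by linarith)] at h3
  linarith

end SummableWeightedGraph
namespace SummableWeightedGraph
variable {V : Type*} {G : SummableWeightedGraph V}

lemma exists_finset_of_lt {S : Set V} {c : ℝ} (h : c < G.setWeight S) :
    ∃ F : Finset V, (∀ v ∈ F, v ∈ S) ∧ c < ∑ v ∈ F, G.deg v := by
  classical
  have hs : HasSum (fun v : S => G.deg v) (G.setWeight S) := (G.deg_summable.subtype S).hasSum
  obtain ⟨F, hF⟩ := (hs.eventually_const_lt h).exists
  refine ⟨F.map (Function.Embedding.subtype _), ?_, ?_⟩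
  · intro v hv
    simp only [Finset.mem_map, Function.Embedding.subtype_apply] at hv
    obtain ⟨a, -, rfl⟩ := hv
    exact a.2
  · simpa using hF

lemma le_setWeight {S : Set V} {F : Finset V} (h : ∀ v ∈ F, v ∈ S) :
    ∑ v ∈ F, G.deg v ≤ G.setWeight S := by
  classical
  rw [setWeight, tsum_subtype S G.deg]
  calc ∑ v ∈ F, G.deg v = ∑ v ∈ F, S.indicator G.deg v :=
        Finset.sum_congr rfl (fun v hv => (Set.indicator_of_mem (h v hv) _).symm)
    _ ≤ _ := (G.deg_summable.indicator S).sum_le_tsum _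
        (fun v _ => Set.indicator_nonneg (fun v _ => (G.deg_pos v).le) v)

lemma setWeight_add_compl (S : Set V) : G.setWeight S + G.setWeight Sᶜ = ∑' v, G.deg v :=
  (G.deg_summable.subtype S).tsum_add_tsum_compl (G.deg_summable.subtype Sᶜ)

lemma exists_median [Nonempty V] (f : V → ℝ) : ∃ t : ℝ,
    G.setWeight {v | t < f v} ≤ G.setWeight {v | t < f v}ᶜ ∧
    G.setWeight {v | f v < t} ≤ G.setWeight {v | f v < t}ᶜ := by
  set W := ∑' v, G.deg v with hW
  have hWpos : 0 < W := by
    obtain ⟨v⟩ := ‹Nonempty V›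
    exact G.deg_summable.tsum_pos (fun v => (G.deg_pos v).le) v (G.deg_pos v)
  have hne : ∀ F : Finset V, W / 2 < ∑ v ∈ F, G.deg v → F.Nonempty := by
    intro F hF
    rw [Finset.nonempty_iff_ne_empty]
    rintro rfl
    simp at hF; linarith
  set A := {s : ℝ | G.setWeight {v | s < f v} ≤ W / 2} with hA
  -- a finite set on which `f ≤ s`
  have hmem : ∀ (F : Finset V) (s : ℝ), W / 2 < ∑ v ∈ F, G.deg v → (∀ v ∈ F, f v ≤ s) → s ∈ A := by
    intro F s hF hs
    have h1 := le_setWeight (G := G) (S := {v | s < f v}ᶜ) (F := F) (fun v hv => by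
      simpa using hs v hv)
    have h2 := setWeight_add_compl (G := G) {v | s < f v}
    change G.setWeight {v | s < f v} ≤ W / 2
    linarith
  have hnmem : ∀ (F : Finset V) (s : ℝ), W / 2 < ∑ v ∈ F, G.deg v → (∀ v ∈ F, s < f v) → s ∉ A := by
    intro F s hF hs hsA
    have h1 := le_setWeight (G := G) (S := {v | s < f v}) (F := F) hs
    have : G.setWeight {v | s < f v} ≤ W / 2 := hsA
    linarith
  obtain ⟨F, -, hF⟩ := exists_finset_of_lt (G := G) (S := Set.univ) (c := W / 2) (by
    have := setWeight_add_compl (G := G) Set.univ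
    have h0 : G.setWeight (Set.univᶜ : Set V) = 0 := by simp [setWeight]
    linarith)
  obtain ⟨a, -, ha⟩ := F.exists_max_image f (hne F hF)
  obtain ⟨b, -, hb⟩ := F.exists_min_image f (hne F hF)
  have hAne : A.Nonempty := ⟨f a, hmem F _ hF ha⟩
  have hAbdd : BddBelow A := by
    refine ⟨f b, fun s hs => ?_⟩
    by_contra hlt
    exact hnmem F s hF (fun v hv => (not_le.mp hlt).trans_le (hb v hv)) hs
  refine ⟨sInf A, ?_, ?_⟩
  · have h2 := setWeight_add_compl (G := G) {v | sInf A < f v}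
    suffices h : G.setWeight {v | sInf A < f v} ≤ W / 2 by linarith
    by_contra hlt
    obtain ⟨F', hF'S, hF'⟩ := exists_finset_of_lt (not_le.mp hlt)
    obtain ⟨c, hc, hcm⟩ := F'.exists_min_image f (hne _ hF')
    obtain ⟨s, hsA, hs⟩ := exists_lt_of_csInf_lt hAne (show sInf A < f c from hF'S c hc)
    exact hnmem F' s hF' (fun v hv => hs.trans_le (hcm v hv)) hsA
  · have h2 := setWeight_add_compl (G := G) {v | f v < sInf A}
    suffices h : G.setWeight {v | f v < sInf A} ≤ W / 2 by linarith
    by_contra hlt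
    obtain ⟨F', hF'S, hF'⟩ := exists_finset_of_lt (not_le.mp hlt)
    obtain ⟨c, hc, hcm⟩ := F'.exists_max_image f (hne _ hF')
    have h3 : f c < sInf A := hF'S c hc
    exact absurd (csInf_le hAbdd (hmem F' (f c) hF' hcm)) (not_le.mpr h3)

lemma cheeger_ineq [Countable V] [Nonempty V] {f : V → ℝ} (hf : G.L2 f)
    (h0 : ∑' v, G.deg v * f v = 0) :
    2 * (1 - Real.sqrt (1 - G.cheegerConst ^ 2)) * ∑' v, G.deg v * f v ^ 2 ≤ G.D f f := by
  obtain ⟨t, ht1, ht2⟩ := exists_median (G := G) f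
  have hg := hf.sub_const t
  have hp : G.L2 (fun v => max (f v - t) 0) := hg.mono (fun v => by
    rcases le_total (f v - t) 0 with h | h
    · rw [max_eq_right h, zero_pow two_ne_zero]; exact sq_nonneg _
    · rw [max_eq_left h])
  have hn : G.L2 (fun v => max (t - f v) 0) := hg.mono (fun v => by
    rcases le_total (t - f v) 0 with h | h
    · rw [max_eq_right h, zero_pow two_ne_zero]; exact sq_nonneg _
    · rw [max_eq_left h]; nlinarith)
  have k1 := key (fun v => le_max_right _ _) hp (by simpa using ht1)
  have k2 := key (fun v => le_max_right _ _) hn (by simpa using ht2)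
  have hc : 0 ≤ 1 - Real.sqrt (1 - G.cheegerConst ^ 2) := by
    rw [sub_nonneg, Real.sqrt_le_left zero_le_one]
    nlinarith [sq_nonneg G.cheegerConst]
  have hD : G.D (fun v => max (f v - t) 0) (fun v => max (f v - t) 0)
      + G.D (fun v => max (t - f v) 0) (fun v => max (t - f v) 0) ≤ G.D f f := by
    unfold D
    rw [← (hp.sD hp).tsum_add (hn.sD hn)]
    refine ((hp.sD hp).add (hn.sD hn)).tsum_le_tsum (fun p => ?_) (hf.sD hf)
    rw [← mul_add]
    refine mul_le_mul_of_nonneg_left ?_ (G.nonneg _ _)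
    rcases le_total (f p.1) t with h1 | h1 <;> rcases le_total (f p.2) t with h2 | h2
    · rw [max_eq_right (sub_nonpos.mpr h1), max_eq_right (sub_nonpos.mpr h2),
        max_eq_left (sub_nonneg.mpr h1), max_eq_left (sub_nonneg.mpr h2)]; nlinarith
    · rw [max_eq_right (sub_nonpos.mpr h1), max_eq_left (sub_nonneg.mpr h2),
        max_eq_left (sub_nonneg.mpr h1), max_eq_right (sub_nonpos.mpr h2)]; nlinarith
    · rw [max_eq_left (sub_nonneg.mpr h1), max_eq_right (sub_nonpos.mpr h2),
        max_eq_right (sub_nonpos.mpr h1), max_eq_left (sub_nonneg.mpr h2)]; nlinarith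
    · rw [max_eq_left (sub_nonneg.mpr h1), max_eq_left (sub_nonneg.mpr h2),
        max_eq_right (sub_nonpos.mpr h1), max_eq_right (sub_nonpos.mpr h2)]; nlinarith
  have hfs : Summable (fun v => G.deg v * f v) := by
    simpa using summable_mul_of_sq (fun v => (G.deg_pos v).le) hf (L2.const (G := G) 1)
  have hN : ∑' v, G.deg v * f v ^ 2 ≤ ∑' v, G.deg v * (max (f v - t) 0) ^ 2
      + ∑' v, G.deg v * (max (t - f v) 0) ^ 2 := by
    rw [← Summable.tsum_add hp hn]
    have e : ∑' v, (G.deg v * f v ^ 2 - 2 * t * (G.deg v * f v)) = ∑' v, G.deg v * f v ^ 2 := by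
      rw [Summable.tsum_sub hf (hfs.mul_left _), tsum_mul_left, h0]; ring
    rw [← e]
    refine Summable.tsum_le_tsum (fun v => ?_) (Summable.sub hf (hfs.mul_left _)) (Summable.add hp hn)
    have hd := (G.deg_pos v).le
    beta_reduce
    have := mul_nonneg hd (sq_nonneg t)
    rcases le_total (f v) t with h1 | h1
    · rw [max_eq_right (sub_nonpos.mpr h1), max_eq_left (sub_nonneg.mpr h1)]; nlinarith
    · rw [max_eq_left (sub_nonneg.mpr h1), max_eq_right (sub_nonpos.mpr h1)]; nlinarith
  have := mul_le_mul_of_nonneg_left hN hc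
  linarith

end SummableWeightedGraph
section Hilb
variable {H : Type*} [NormedAddCommGroup H] [InnerProductSpace ℝ H] [CompleteSpace H]
open scoped InnerProductSpace

lemma hilb_not_mem_spectrum (T : H →L[ℝ] H) (e : H) (he : ‖e‖ = 1) (hTe : T e = 0)
    (hTe' : ∀ x, ⟪T x, e⟫_ℝ = 0) {c l : ℝ} (hl : 0 < l) (hlc : l < c)
    (hT : ∀ x, ⟪x, e⟫_ℝ = 0 → c * ‖x‖ ^ 2 ≤ ⟪T x, x⟫_ℝ) : l ∉ spectrum ℝ T := by
  rw [spectrum.notMem_iff]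
  set S : H →L[ℝ] H := algebraMap ℝ (H →L[ℝ] H) l - T with hS
  have hSx : ∀ x, S x = l • x - T x := fun x => by simp [hS, Algebra.algebraMap_eq_smul_one]
  set R : H →L[ℝ] H := (2 : ℝ) • (innerSL ℝ e).smulRight e - 1 with hR
  have hRx : ∀ x, R x = (2 * ⟪e, x⟫_ℝ) • e - x := fun x => by
    simp [hR, mul_smul]
  have hee : ⟪e, e⟫_ℝ = 1 := by rw [real_inner_self_eq_norm_sq, he]; norm_num
  have hRR : R * R = 1 := by
    ext x
    simp only [mul_apply_eq_comp, hRx, inner_sub_right, inner_smul_right, hee,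
      one_apply_eq_self]
    module
  have hRu : IsUnit R := ⟨⟨R, R, hRR, hRR⟩, rfl⟩
  have hu : IsUnit (R * S) := by
    set d := min l (c - l) with hd
    have hdpos : 0 < d := lt_min hl (by linarith)
    refine ContinuousLinearMap.isUnit_of_forall_le_norm_inner_map (𝕜 := ℝ) _ (c := ⟨d, hdpos.le⟩) hdpos
      (fun x => ?_)
    refine le_trans ?_ (le_abs_self _)
    change ‖x‖ ^ 2 * d ≤ _
    set a := ⟪e, x⟫_ℝ with ha
    set g := x - a • e with hg
    have hge : ⟪g, e⟫_ℝ = 0 := by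
      rw [hg, inner_sub_left, inner_smul_left, hee, real_inner_comm, ← ha]; simp
    have heg : ⟪e, g⟫_ℝ = 0 := by rw [real_inner_comm, hge]
    have hx : x = a • e + g := by rw [hg]; abel
    have hTx : T x = T g := by rw [hx, map_add, map_smul, hTe]; simp
    have hTg := hT g hge
    have hnx : ‖x‖ ^ 2 = a ^ 2 + ‖g‖ ^ 2 := by
      rw [← real_inner_self_eq_norm_sq, ← real_inner_self_eq_norm_sq]
      nth_rewrite 1 2 [hx]
      simp only [inner_add_left, inner_add_right, inner_smul_left, inner_smul_right, hee, hge, heg]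
      simp; ring
    have heT : ⟪e, T g⟫_ℝ = 0 := by rw [real_inner_comm]; exact hTe' g
    have e1 : ⟪(R * S) x, x⟫_ℝ = l * a ^ 2 - l * ‖g‖ ^ 2 + ⟪T g, g⟫_ℝ := by
      rw [mul_apply_eq_comp, hRx, hSx, hTx, hx, ← real_inner_self_eq_norm_sq]
      simp only [inner_add_left, inner_add_right, inner_sub_left, inner_sub_right,
        inner_smul_left, inner_smul_right, hee, hge, heg, hTe' g, heT]
      simp; ring
    rw [e1, hnx]
    have d1 : d ≤ l := min_le_left _ _
    have d2 : d ≤ c - l := min_le_right _ _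
    nlinarith [mul_le_mul_of_nonneg_right d1 (sq_nonneg a),
      mul_le_mul_of_nonneg_right d2 (sq_nonneg ‖g‖)]
  have : S = R * (R * S) := by rw [← mul_assoc, hRR, one_mul]
  rw [this]
  exact hRu.mul hu

lemma hilb_exists_spectrum (T : H →L[ℝ] H) (hsym : ∀ x y, ⟪T x, y⟫_ℝ = ⟪x, T y⟫_ℝ)
    (hpos : ∀ x, 0 ≤ ⟪T x, x⟫_ℝ) (hne : T ≠ 0) : ‖T‖ ∈ spectrum ℝ T := by
  by_contra hmem
  rw [spectrum.notMem_iff] at hmem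
  set M := ‖T‖ with hM
  have hMpos : 0 < M := norm_pos_iff.mpr hne
  have hplus : IsUnit (algebraMap ℝ (H →L[ℝ] H) M + T) := by
    refine ContinuousLinearMap.isUnit_of_forall_le_norm_inner_map (𝕜 := ℝ) _ (c := ⟨M, hMpos.le⟩)
      hMpos (fun x => ?_)
    refine le_trans ?_ (le_abs_self _)
    change ‖x‖ ^ 2 * M ≤ _
    have := hpos x
    simp only [_root_.add_apply, Algebra.algebraMap_eq_smul_one,
      _root_.smul_apply, one_apply_eq_self, inner_add_left,
      inner_smul_left, real_inner_self_eq_norm_sq]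
    simp; linarith
  obtain ⟨U, hU⟩ := hplus.mul hmem
  have hUx : ∀ x, (U : H →L[ℝ] H) x = (M ^ 2) • x - T (T x) := by
    intro x
    rw [hU]
    simp only [mul_apply_eq_comp, _root_.add_apply,
      _root_.sub_apply, Algebra.algebraMap_eq_smul_one,
      _root_.smul_apply, one_apply_eq_self, map_sub, map_smul]
    module
  set C := ‖(↑U⁻¹ : H →L[ℝ] H)‖ with hC
  have hC0 : 0 ≤ C := norm_nonneg _
  have hinv : ∀ x, ‖x‖ ≤ C * ‖(U : H →L[ℝ] H) x‖ := by
    intro x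
    have : (↑U⁻¹ : H →L[ℝ] H) ((U : H →L[ℝ] H) x) = x := by
      rw [← mul_apply_eq_comp, Units.inv_mul]; rfl
    calc ‖x‖ = ‖(↑U⁻¹ : H →L[ℝ] H) ((U : H →L[ℝ] H) x)‖ := by rw [this]
      _ ≤ _ := ContinuousLinearMap.le_opNorm _ _
  have hnorm : ∀ x, ‖(U : H →L[ℝ] H) x‖ ^ 2 ≤ M ^ 2 * (M ^ 2 * ‖x‖ ^ 2 - ‖T x‖ ^ 2) := by
    intro x
    rw [hUx, norm_sub_sq_real, norm_smul, inner_smul_left, ← hsym, real_inner_self_eq_norm_sq]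
    have h1 : ‖T (T x)‖ ^ 2 ≤ (M * ‖T x‖) ^ 2 :=
      pow_le_pow_left₀ (norm_nonneg _) (T.le_opNorm _) 2
    simp
    nlinarith
  -- strict contraction
  set K := C ^ 2 * M ^ 2 + 1 with hK
  have hKpos : 0 < K := by positivity
  have hTx : ∀ x, ‖T x‖ ^ 2 ≤ (M ^ 2 - 1 / K) * ‖x‖ ^ 2 := by
    intro x
    have h1 : ‖x‖ ^ 2 ≤ (C * ‖(U : H →L[ℝ] H) x‖) ^ 2 := pow_le_pow_left₀ (norm_nonneg _) (hinv x) 2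
    have h2 := mul_le_mul_of_nonneg_left (hnorm x) (sq_nonneg C)
    have h3 : ‖T x‖ ^ 2 ≤ (M * ‖x‖) ^ 2 := pow_le_pow_left₀ (norm_nonneg _) (T.le_opNorm _) 2
    have h4 : ‖x‖ ^ 2 ≤ K * (M ^ 2 * ‖x‖ ^ 2 - ‖T x‖ ^ 2) := by rw [hK]; nlinarith
    have h5 : 1 / K * ‖x‖ ^ 2 ≤ M ^ 2 * ‖x‖ ^ 2 - ‖T x‖ ^ 2 := by
      rw [one_div, inv_mul_le_iff₀ hKpos]; exact h4
    linarith
  have hle : M ≤ Real.sqrt (M ^ 2 - 1 / K) := by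
    refine T.opNorm_le_bound (Real.sqrt_nonneg _) (fun x => ?_)
    rw [← Real.sqrt_sq (norm_nonneg x), ← Real.sqrt_mul' _ (sq_nonneg _)]
    exact Real.le_sqrt_of_sq_le (hTx x)
  have hKp : 0 < 1 / K := by positivity
  have h6 : Real.sqrt (M ^ 2 - 1 / K) < M := by
    rw [Real.sqrt_lt' hMpos]; linarith
  linarith

end Hilb
namespace SummableWeightedGraph
variable {V : Type*} {G : SummableWeightedGraph V} [MeasurableSpace V]
  [MeasurableSingletonClass V] [Countable V]
open scoped InnerProductSpace

lemma ae_all {p : V → Prop} (h : ∀ᵐ v ∂G.measure, p v) (v : V) : p v := by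
  rw [measure, Measure.ae_sum_iff] at h
  have h1 := h v
  rw [Measure.ae_ennreal_smul_measure_iff (by simpa using G.deg_pos v), ae_dirac_eq] at h1
  exact h1

lemma integrable_iff (f : V → ℝ) :
    Integrable f G.measure ↔ Summable (fun v => G.deg v * ‖f v‖) := by
  rw [measure, integrable_sum_dirac_iff (fun _ => ENNReal.ofReal_ne_top)]
  simp only [ENNReal.toReal_ofReal (G.deg_pos _).le]

lemma integral_eq (f : V → ℝ) : ∫ v, f v ∂G.measure = ∑' v, G.deg v * f v := by
  rw [measure, integral_sum_dirac (fun _ => ENNReal.ofReal_ne_top)]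
  simp only [ENNReal.toReal_ofReal (G.deg_pos _).le, smul_eq_mul]

lemma memLp_iff (f : V → ℝ) : MemLp f 2 G.measure ↔ G.L2 f := by
  have hm : Measurable f := measurable_of_countable f
  rw [memLp_two_iff_integrable_sq hm.aestronglyMeasurable, integrable_iff]
  simp [L2]

lemma Lp_L2 (f : Lp ℝ 2 G.measure) : G.L2 f := (memLp_iff _).mp (Lp.memLp f)

lemma toLp_apply {f : V → ℝ} (hf : MemLp f 2 G.measure) (v : V) : hf.toLp f v = f v :=
  ae_all hf.coeFn_toLp v

lemma inner_eq (f g : Lp ℝ 2 G.measure) : ⟪f, g⟫_ℝ = ∑' v, G.deg v * (f v * g v) := by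
  rw [L2.inner_def, integral_eq]
  refine tsum_congr (fun v => ?_)
  simp [mul_comm]

lemma inner_lap {T : Lp ℝ 2 G.measure →L[ℝ] Lp ℝ 2 G.measure} (hT : G.IsLaplacian T)
    (f g : Lp ℝ 2 G.measure) : ⟪T f, g⟫_ℝ = G.D f g / 2 := by
  rw [inner_eq, (Lp_L2 f).D_eq (Lp_L2 g)]
  simp only [ae_all (hT f)]
  ring

end SummableWeightedGraph


open SummableWeightedGraph in
/-- for every summable weighted graph `(G,m)`,
`1 - √(1 - h(G,m)²) ≤ λ_gap(Δ)`. -/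
theorem cheeger_lower_bound_for_gap {V : Type*} [MeasurableSpace V]
    [MeasurableSingletonClass V] [Countable V] [Nonempty V] (G : SummableWeightedGraph V)
    (Δ : Lp ℝ 2 G.measure →L[ℝ] Lp ℝ 2 G.measure) (hΔ : G.IsLaplacian Δ) :
    1 - Real.sqrt (1 - G.cheegerConst ^ 2) ≤ sInf {x : ℝ | x ∈ spectrum ℝ Δ ∧ 0 < x} := by
  have v₀ : V := Classical.arbitrary V
  set c := 1 - Real.sqrt (1 - G.cheegerConst ^ 2) with hc
  set W := ∑' v, G.deg v with hW
  have hWpos : 0 < W := G.deg_summable.tsum_pos (fun v => (G.deg_pos v).le) v₀ (G.deg_pos v₀)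
  have hsym : ∀ x y, inner ℝ (Δ x) y = inner ℝ x (Δ y) := by
    intro x y
    rw [inner_lap hΔ, D_comm, ← inner_lap hΔ, real_inner_comm]
  have hpos : ∀ x, 0 ≤ inner ℝ (Δ x) x := by
    intro x
    rw [inner_lap hΔ]
    exact div_nonneg (D_nonneg _) two_pos.le
  have hne : Δ ≠ 0 := by
    classical
    intro h0
    have hF : G.L2 (fun v => if v = v₀ then (1 : ℝ) else 0) := (L2.const (G := G) 1).mono (fun v => by
      split_ifs <;> norm_num)
    have hmF := (memLp_iff _).mpr hF
    have h1 := inner_lap hΔ (hmF.toLp _) (hmF.toLp _)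
    have hcoe : ((hmF.toLp _ : Lp ℝ 2 G.measure) : V → ℝ) = fun v => if v = v₀ then (1 : ℝ) else 0 :=
      funext (toLp_apply hmF)
    rw [hcoe, hF.D_eq hF, tsum_eq_single v₀ (by intro v hv; simp [hv])] at h1
    have h2 : ∑' u, G.m v₀ u * (if u = v₀ then (1 : ℝ) else 0) = 0 := by
      rw [tsum_eq_single v₀ (by intro v hv; simp [hv])]
      simp [G.loopless]
    rw [h2, h0] at h1
    have := G.deg_pos v₀
    simp at h1
    linarith
  have hspec := hilb_exists_spectrum Δ hsym hpos hne
  refine le_csInf ⟨‖Δ‖, hspec, norm_pos_iff.mpr hne⟩ ?_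
  rintro l ⟨hl, hlpos⟩
  by_contra hlt
  rw [not_le] at hlt
  have hmE := (memLp_iff (G := G) _).mpr (L2.const (G := G) (Real.sqrt W)⁻¹)
  set e : Lp ℝ 2 G.measure := hmE.toLp _ with he
  have hcoe : (e : V → ℝ) = fun _ => (Real.sqrt W)⁻¹ := funext (toLp_apply hmE)
  have hnorm : ‖e‖ = 1 := by
    have h1 : ‖e‖ ^ 2 = 1 := by
      rw [← real_inner_self_eq_norm_sq, inner_eq, hcoe]
      rw [tsum_mul_right, ← hW, ← mul_inv, Real.mul_self_sqrt hWpos.le]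
      exact mul_inv_cancel₀ hWpos.ne'
    exact (pow_eq_one_iff_of_nonneg (norm_nonneg _) two_ne_zero).mp h1
  have hTe' : ∀ x, inner ℝ (Δ x) e = 0 := by
    intro x
    rw [inner_lap hΔ, hcoe, D_const_right, zero_div]
  have hTe : Δ e = 0 := by
    have := hTe' (Δ e)
    rw [hsym] at this
    exact inner_self_eq_zero.mp this
  refine hilb_not_mem_spectrum Δ e hnorm hTe hTe' hlpos hlt ?_ hl
  intro x hx
  rw [inner_eq, hcoe] at hx
  have h0 : ∑' v, G.deg v * x v = 0 := by
    have e1 : ∀ v, G.deg v * (x v * (Real.sqrt W)⁻¹) = (G.deg v * x v) * (Real.sqrt W)⁻¹ :=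
      fun v => by ring
    simp only [e1] at hx
    rw [tsum_mul_right] at hx
    exact (mul_eq_zero.mp hx).resolve_right (inv_ne_zero (Real.sqrt_pos.mpr hWpos).ne')
  have h1 := cheeger_ineq (Lp_L2 x) h0
  have h2 : ‖x‖ ^ 2 = ∑' v, G.deg v * x v ^ 2 := by
    rw [← real_inner_self_eq_norm_sq, inner_eq]
    exact tsum_congr (fun v => by ring)
  rw [inner_lap hΔ, h2]
  linarith
end

section
/- Let (K,m) be the infinite complete graph with weights m(i,j) = p_i·p_j, where the p_i are pairwise distinct and decreasing: p_1 > p_2 > p_3 > … > 0, ∑ p_i = 1. Then the random-walk operator P : L²(K,m) → L²(K,m) has a unique positive eigenvalue, namely 1; its negative eigenvalues form a sequence λ_1 < λ_2 < … < 0 with exactly one eigenvalue λ_i in each interval (α_i, α_{i+1}) for i = 1,2,…; and 0 belongs to the spectrum σ(P) (as an accumulation point of eigenvalues) and is the only point of σ(P) that is not an eigenvalue. In particular σ(P) = {0, 1} ∪ {λ_i : i ≥ 1}. -/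
open MeasureTheory

/-- `lam` is an eigenvalue of the bounded operator `T`. -/
def IsEigenvalue {H : Type*} [NormedAddCommGroup H] [NormedSpace ℝ H]
    (T : H →L[ℝ] H) (lam : ℝ) : Prop :=
  ∃ f : H, f ≠ 0 ∧ T f = lam • f

/-- The quantities `αᵢ = -pᵢ/(1-pᵢ)` attached to the infinite complete graph. -/
noncomputable def alpha (p : ℕ → ℝ) (j : ℕ) : ℝ := -p j / (1 - p j)

namespace RW
open Filter Topology

def Mem (p g : ℕ → ℝ) : Prop := Summable fun v => p v * g v ^ 2

/-- d -/
def d (p : ℕ → ℝ) (x : ℝ) (j : ℕ) : ℝ := x * (1 - p j) + p j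

noncomputable def F (p : ℕ → ℝ) (x : ℝ) : ℝ := ∑' j, p j / d p x j

variable {p : ℕ → ℝ}

lemma Mem.const (hsum : HasSum p 1) (c : ℝ) : Mem p fun _ => c :=
  hsum.summable.mul_right _

lemma Mem.sub (hp : ∀ i, 0 < p i) {f g : ℕ → ℝ} (hf : Mem p f) (hg : Mem p g) :
    Mem p fun v => f v - g v := by
  refine Summable.of_nonneg_of_le (fun v => by have := hp v; positivity) (fun v => ?_)
    ((hf.add hg).mul_left 2)
  have := mul_nonneg (hp v).le (sq_nonneg (f v + g v))
  nlinarith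

lemma Mem.bmul (hp : ∀ i, 0 < p i) {f g : ℕ → ℝ} (hf : Mem p f) (C : ℝ)
    (hg : ∀ v, |g v| ≤ C) : Mem p fun v => f v * g v := by
  refine Summable.of_nonneg_of_le (fun v => by have := hp v; positivity) (fun v => ?_)
    (hf.mul_left (C ^ 2))
  have h1 : g v ^ 2 ≤ C ^ 2 := by
    rw [← sq_abs]; exact pow_le_pow_left₀ (abs_nonneg _) (hg v) 2
  have := mul_le_mul_of_nonneg_left h1 (mul_nonneg (hp v).le (sq_nonneg (f v)))
  nlinarith

lemma Mem.upd {f : ℕ → ℝ} (hf : Mem p f) (k : ℕ) (c : ℝ) :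
    Mem p (Function.update f k c) := by
  have : (fun v => p v * (Function.update f k c) v ^ 2)
      = Function.update (fun v => p v * f v ^ 2) k (p k * c ^ 2) := by
    funext v
    by_cases h : v = k
    · subst h; simp
    · simp [h]
  unfold Mem
  rw [this]
  exact Summable.update hf k _

lemma Mem.summable (hp : ∀ i, 0 < p i) (hsum : HasSum p 1) {f : ℕ → ℝ} (hf : Mem p f) :
    Summable fun v => p v * f v := by
  refine Summable.of_norm_bounded (hsum.summable.add hf) (fun v => ?_)
  rw [Real.norm_eq_abs, abs_mul, abs_of_pos (hp v), ← sq_abs (f v)]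
  have := mul_nonneg (hp v).le (sq_nonneg (|f v| - 1))
  nlinarith [mul_nonneg (hp v).le (abs_nonneg (f v))]

lemma lt_one (hp : ∀ i, 0 < p i) (hsum : HasSum p 1) (v : ℕ) : p v < 1 := by
  have h := hsum.summable.sum_le_tsum {v, v+1} (fun i _ => (hp i).le)
  rw [hsum.tsum_eq, Finset.sum_pair (by simp)] at h
  linarith [hp (v+1)]

lemma alpha_eq (hp : ∀ i, 0 < p i) (hsum : HasSum p 1) (x : ℝ) (v : ℕ) :
    d p x v = (1 - p v) * (x - alpha p v) := by
  have : 1 - p v ≠ 0 := by linarith [lt_one hp hsum v]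
  unfold d alpha; field_simp; ring

lemma alpha_mono (hp : ∀ i, 0 < p i) (hanti : StrictAnti p) (hsum : HasSum p 1) :
    StrictMono (alpha p) := by
  intro i j h
  have h1 := hanti h
  have := lt_one hp hsum i
  have := lt_one hp hsum j
  unfold alpha
  rw [div_lt_div_iff₀ (by linarith) (by linarith)]
  nlinarith

lemma alpha_neg (hp : ∀ i, 0 < p i) (hsum : HasSum p 1) (i : ℕ) : alpha p i < 0 := by
  have := lt_one hp hsum i
  unfold alpha
  exact div_neg_of_neg_of_pos (by linarith [hp i]) (by linarith)

lemma alpha_tendsto (hsum : HasSum p 1) : Tendsto (alpha p) atTop (𝓝 0) := by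
  have h := hsum.summable.tendsto_atTop_zero
  have := h.neg.div (h.const_sub 1) (by norm_num)
  rw [neg_zero, zero_div] at this
  exact this

lemma d_tendsto (hsum : HasSum p 1) (x : ℝ) : Tendsto (d p x) atTop (𝓝 x) := by
  have h := hsum.summable.tendsto_atTop_zero
  have := ((h.const_sub 1).const_mul x).add h
  rw [sub_zero, mul_one, add_zero] at this
  exact this

lemma d_bdd (hsum : HasSum p 1) {x : ℝ} (hx : x ≠ 0) : ∃ C, ∀ v, |(d p x v)⁻¹| ≤ C := by
  have h := Metric.isBounded_range_of_tendsto _ ((d_tendsto hsum x).inv₀ hx)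
  obtain ⟨C, hC⟩ := h.exists_norm_le
  exact ⟨C, fun v => hC _ ⟨v, rfl⟩⟩

lemma F_summable (hp : ∀ i, 0 < p i) (hsum : HasSum p 1) {x : ℝ} (hx : x ≠ 0) :
    Summable fun j => p j / d p x j := by
  obtain ⟨C, hC⟩ := d_bdd hsum hx
  have := ((Mem.const hsum 1).bmul hp C hC).summable hp hsum
  simpa [div_eq_mul_inv] using this

/-- eigen equation -/
def Eig (p : ℕ → ℝ) (x : ℝ) : Prop :=
  ∃ g : ℕ → ℝ, Mem p g ∧ g ≠ 0 ∧ ∀ v, (∑' u, p u * g u - p v * g v) / (1 - p v) = x * g v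

lemma eig_eq (hp : ∀ i, 0 < p i) (hsum : HasSum p 1) (S x t : ℝ) (v : ℕ) (y : ℝ):
    (S - p v * t) / (1 - p v) - x * t = y ↔ d p x v * t = S - (1 - p v) * y := by
  have : 1 - p v ≠ 0 := by linarith [lt_one hp hsum v]
  unfold d
  rw [sub_eq_iff_eq_add, div_eq_iff this]
  constructor <;> intro h <;> linarith

lemma eig_zero (hp : ∀ i, 0 < p i) (hsum : HasSum p 1) : ¬ Eig p 0 := by
  rintro ⟨g, hg, hne, h⟩
  have h2 : ∀ v, p v * g v = ∑' u, p u * g u := by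
    intro v
    have := (eig_eq hp hsum _ 0 (g v) v 0).1 (by linarith [h v])
    simpa [d] using this
  have hs := (hg.summable hp hsum)
  have h3 := hs.tendsto_atTop_zero.congr h2
  have h4 := tendsto_nhds_unique h3 tendsto_const_nhds
  apply hne
  funext v
  have := h2 v
  rw [← h4] at this
  simpa [(hp v).ne'] using this

lemma eig_iff (hp : ∀ i, 0 < p i) (hanti : StrictAnti p) (hsum : HasSum p 1) {x : ℝ}
    (hx : x ≠ 0) : Eig p x ↔ (∀ j, d p x j ≠ 0) ∧ F p x = 1 := by
  constructor
  · rintro ⟨g, hg, hne, h⟩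
    have h2 : ∀ v, d p x v * g v = ∑' u, p u * g u := by
      intro v
      have := (eig_eq hp hsum _ x (g v) v 0).1 (by linarith [h v])
      simpa using this
    have hd : ∀ j, d p x j ≠ 0 := by
      intro j hj
      have hS := h2 j
      rw [hj, zero_mul] at hS
      have h0 : ∀ v, v ≠ j → g v = 0 := by
        intro v hv
        have h5 := h2 v
        rw [← hS] at h5
        rcases mul_eq_zero.1 h5 with h6 | h6
        · exfalso
          rw [alpha_eq hp hsum] at h6 hj
          have a1 := lt_one hp hsum v
          have a2 := lt_one hp hsum j
          have b1 : x - alpha p v = 0 := (mul_eq_zero.1 h6).resolve_left (by linarith)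
          have b2 : x - alpha p j = 0 := (mul_eq_zero.1 hj).resolve_left (by linarith)
          exact hv ((alpha_mono hp hanti hsum).injective (by linarith))
        · exact h6
      rw [tsum_eq_single j (fun v hv => by rw [h0 v hv, mul_zero])] at hS
      have hj0 : g j = 0 := (mul_eq_zero.1 hS.symm).resolve_left (hp j).ne'
      apply hne
      funext v
      by_cases hv : v = j
      · rw [hv]; exact hj0
      · exact h0 v hv
    refine ⟨hd, ?_⟩
    set S := ∑' u, p u * g u with hS
    have hgv : ∀ v, g v = S / d p x v := fun v => by
      rw [eq_div_iff (hd v), mul_comm]; exact h2 v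
    have hS0 : S ≠ 0 := by
      intro h0
      apply hne
      funext v
      rw [hgv v, h0]; simp
    have : S = S * F p x := by
      unfold F
      rw [← tsum_mul_left]
      conv_lhs => rw [hS]
      refine tsum_congr fun v => ?_
      rw [hgv v]; ring
    exact (mul_left_cancel₀ hS0 (by linarith)).symm
  · rintro ⟨hd, hF⟩
    obtain ⟨C, hC⟩ := d_bdd hsum hx
    refine ⟨fun v => 1 * (d p x v)⁻¹, (Mem.const hsum 1).bmul hp C hC, ?_, fun v => ?_⟩
    · intro h
      have := congrFun h 0
      simp [hd 0] at this
    · have : ∑' u, p u * (1 * (d p x u)⁻¹) = 1 := by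
        refine Eq.trans ?_ hF
        unfold F
        exact tsum_congr fun v => by rw [one_mul, div_eq_mul_inv]
      rw [this, ← sub_eq_zero, eig_eq hp hsum]
      simp [hd v]

lemma surj (hp : ∀ i, 0 < p i) (hanti : StrictAnti p) (hsum : HasSum p 1) {x : ℝ}
    (hx : x ≠ 0) (hn : ¬ Eig p x) {g : ℕ → ℝ} (hg : Mem p g) :
    ∃ f, Mem p f ∧ ∀ v, (∑' u, p u * f u - p v * f v) / (1 - p v) - x * f v = g v := by
  obtain ⟨C, hC⟩ := d_bdd hsum hx
  have hqg : Mem p fun v => g v * (1 - p v) := by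
    refine hg.bmul hp 1 fun v => ?_
    have := lt_one hp hsum v
    have := hp v
    rw [abs_le]; constructor <;> linarith
  have key : ∀ S : ℝ, Mem p fun v => (S - g v * (1 - p v)) * (d p x v)⁻¹ := fun S =>
    ((Mem.const hsum S).sub hp hqg).bmul hp C hC
  by_cases hd : ∀ j, d p x j ≠ 0
  · have hF : 1 - F p x ≠ 0 := fun h => hn ((eig_iff hp hanti hsum hx).2 ⟨hd, by linarith⟩)
    set A := ∑' v, p v * (g v * (1 - p v) * (d p x v)⁻¹) with hA
    have hAs := (hqg.bmul hp C hC).summable hp hsum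
    obtain ⟨S, hS⟩ : ∃ S : ℝ, S = S * F p x - A := ⟨-A / (1 - F p x), by field_simp; ring⟩
    refine ⟨_, key S, fun v => ?_⟩
    have : ∑' u, p u * ((S - g u * (1 - p u)) * (d p x u)⁻¹) = S := by
      conv_rhs => rw [hS]
      unfold F
      rw [hA, ← tsum_mul_left, ← ((F_summable hp hsum hx).mul_left S).tsum_sub hAs]
      refine tsum_congr fun v => ?_
      rw [div_eq_mul_inv]; ring
    rw [this, eig_eq hp hsum]
    have := hd v
    field_simp
  · push Not at hd
    obtain ⟨k, hk⟩ := hd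
    have hdv : ∀ v, v ≠ k → d p x v ≠ 0 := by
      intro v hv h6
      rw [alpha_eq hp hsum] at h6 hk
      have a1 := lt_one hp hsum v
      have a2 := lt_one hp hsum k
      have b1 : x - alpha p v = 0 := (mul_eq_zero.1 h6).resolve_left (by linarith)
      have b2 : x - alpha p k = 0 := (mul_eq_zero.1 hk).resolve_left (by linarith)
      exact hv ((alpha_mono hp hanti hsum).injective (by linarith))
    set S := g k * (1 - p k) with hS
    set h : ℕ → ℝ := fun v => (S - g v * (1 - p v)) * (d p x v)⁻¹ with hh
    have hM : Mem p h := key S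
    have hks : h k = 0 := by simp [hh, hk]
    set c := (S - ∑' u, p u * h u) / p k with hc
    refine ⟨Function.update h k c, hM.upd k c, fun v => ?_⟩
    have : ∑' u, p u * (Function.update h k c) u = S := by
      have e : (fun u => p u * (Function.update h k c) u)
          = fun u => p u * h u + (if u = k then p k * c else 0) := by
        funext u
        by_cases hu : u = k
        · subst hu; simp [hks]
        · simp [hu]
      rw [e, (hM.summable hp hsum).tsum_add (summable_of_ne_finset_zero (s := {k}) (by
        intro b hb; simp at hb; simp [hb])), tsum_ite_eq, hc]
      have := (hp k).ne'
      field_simp; ring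
    rw [this, eig_eq hp hsum]
    by_cases hv : v = k
    · subst hv; rw [hk, hS]; ring
    · have := hdv v hv
      simp only [Function.update_of_ne hv, hh]
      field_simp

lemma F_lt (hp : ∀ i, 0 < p i) (hsum : HasSum p 1) {x y : ℝ} (hx : x ≠ 0) (hy : y ≠ 0)
    (hxy : x < y) (h : ∀ j, 0 < d p x j * d p y j) : F p y < F p x := by
  have key : ∀ j, p j / d p y j < p j / d p x j := by
    intro j
    have h1 : d p x j < d p y j := by
      unfold d; nlinarith [lt_one hp hsum j]
    have h2 := h j
    have h3 : d p x j ≠ 0 := fun h => by simp [h] at h2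
    have h4 : d p y j ≠ 0 := fun h => by simp [h] at h2
    have : p j / d p x j - p j / d p y j
      = p j * (d p y j - d p x j) / (d p x j * d p y j) := by field_simp
    have h5 : 0 < p j * (d p y j - d p x j) / (d p x j * d p y j) :=
      div_pos (mul_pos (hp j) (by linarith)) h2
    linarith
  exact Summable.tsum_lt_tsum (fun j => (key j).le) (key 0) (F_summable hp hsum hy)
    (F_summable hp hsum hx)

lemma d_pos (hp : ∀ i, 0 < p i) (hsum : HasSum p 1) {x : ℝ} (hx : 0 < x) (j : ℕ) :
    0 < d p x j := by
  have := lt_one hp hsum j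
  have := mul_pos hx (show 0 < 1 - p j by linarith)
  have := hp j
  unfold d; linarith

lemma F_one (hsum : HasSum p 1) : F p 1 = 1 := by
  simp [F, d, hsum.tsum_eq]

lemma eig_one (hp : ∀ i, 0 < p i) (hanti : StrictAnti p) (hsum : HasSum p 1) : Eig p 1 := by
  rw [eig_iff hp hanti hsum one_ne_zero]
  exact ⟨fun j => (d_pos hp hsum one_pos j).ne', F_one hsum⟩

lemma eig_pos (hp : ∀ i, 0 < p i) (hanti : StrictAnti p) (hsum : HasSum p 1) {x : ℝ}
    (hx : 0 < x) (h : Eig p x) : x = 1 := by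
  rw [eig_iff hp hanti hsum hx.ne'] at h
  have hd : ∀ j, 0 < d p x j * d p 1 j := fun j =>
    mul_pos (d_pos hp hsum hx j) (d_pos hp hsum one_pos j)
  rcases lt_trichotomy x 1 with h1 | h1 | h1
  · have := F_lt hp hsum hx.ne' one_ne_zero h1 hd
    linarith [F_one hsum, h.2]
  · exact h1
  · have := F_lt hp hsum one_ne_zero hx.ne' h1 (fun j => by linarith [hd j])
    linarith [F_one hsum, h.2]

lemma eig_neg (hp : ∀ i, 0 < p i) (hanti : StrictAnti p) (hsum : HasSum p 1) {x : ℝ}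
    (hx : x < 0) (h : Eig p x) : ∃ i, x ∈ Set.Ioo (alpha p i) (alpha p (i + 1)) := by
  rw [eig_iff hp hanti hsum hx.ne] at h
  obtain ⟨hd, hF⟩ := h
  have hex : ∃ j, x < alpha p j := ((alpha_tendsto hsum).eventually (lt_mem_nhds hx)).exists
  classical
  have h1 := Nat.find_spec hex
  have h2 := fun m => Nat.find_min hex (m := m)
  rcases hn : Nat.find hex with _ | i
  · exfalso
    rw [hn] at h1
    have : F p x ≤ 0 := by
      refine tsum_nonpos fun j => ?_
      have h3 : alpha p 0 ≤ alpha p j := (alpha_mono hp hanti hsum).monotone (Nat.zero_le j)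
      apply div_nonpos_of_nonneg_of_nonpos (hp j).le
      rw [alpha_eq hp hsum]
      have := lt_one hp hsum j
      exact mul_nonpos_of_nonneg_of_nonpos (by linarith) (by linarith)
    linarith
  · rw [hn] at h1 h2
    refine ⟨i, lt_of_le_of_ne (not_lt.1 (h2 i (Nat.lt_succ_self i))) ?_, h1⟩
    intro h
    apply hd i
    rw [alpha_eq hp hsum, h]; simp

lemma d_sign (hp : ∀ i, 0 < p i) (hanti : StrictAnti p) (hsum : HasSum p 1) {i : ℕ} {a b : ℝ}
    {x : ℝ} (hx : x ∈ Set.Icc a b) (ha : alpha p i < a) (hb : b < alpha p (i + 1)) (j : ℕ) :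
    (j ≤ i ∧ (1 - p 0) * (a - alpha p i) ≤ d p x j) ∨
    (i < j ∧ d p x j ≤ - ((1 - p 0) * (alpha p (i + 1) - b))) := by
  have h0 := lt_one hp hsum 0
  have hj : p j ≤ p 0 := hanti.antitone (Nat.zero_le j)
  rw [alpha_eq hp hsum]
  rcases le_or_gt j i with h | h
  · left
    refine ⟨h, ?_⟩
    have := (alpha_mono hp hanti hsum).monotone h
    apply mul_le_mul <;> linarith [hx.1]
  · right
    refine ⟨h, ?_⟩
    have := (alpha_mono hp hanti hsum).monotone (Nat.succ_le_of_lt h)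
    simp only [Nat.succ_eq_add_one] at this
    have : (1 - p 0) * (alpha p (i + 1) - b) ≤ (1 - p j) * (alpha p j - x) := by
      apply mul_le_mul <;> linarith [hx.2]
    linarith

lemma F_cont (hp : ∀ i, 0 < p i) (hanti : StrictAnti p) (hsum : HasSum p 1) {i : ℕ} {a b : ℝ}
    (ha : alpha p i < a) (hb : b < alpha p (i + 1)) : ContinuousOn (F p) (Set.Icc a b) := by
  have h0 := lt_one hp hsum 0
  set c := min ((1 - p 0) * (a - alpha p i)) ((1 - p 0) * (alpha p (i + 1) - b)) with hc
  have hcpos : 0 < c := lt_min (mul_pos (by linarith) (by linarith))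
    (mul_pos (by linarith) (by linarith))
  have hbd : ∀ j, ∀ x ∈ Set.Icc a b, c ≤ |d p x j| := by
    intro j x hx
    rcases d_sign hp hanti hsum hx ha hb j with ⟨_, h⟩ | ⟨_, h⟩
    · exact (min_le_left _ _).trans (h.trans (le_abs_self _))
    · exact (min_le_right _ _).trans ((by linarith : _ ≤ - d p x j).trans (neg_le_abs _))
  unfold F
  refine continuousOn_tsum (u := fun j => p j / c) (fun j => ?_) (hsum.summable.div_const c) ?_
  · refine ContinuousOn.div continuousOn_const (by unfold d; fun_prop) ?_
    intro x hx h
    have := hbd j x hx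
    rw [h, abs_zero] at this
    linarith
  · intro j x hx
    rw [norm_div, Real.norm_eq_abs, Real.norm_eq_abs, abs_of_pos (hp j)]
    exact div_le_div_of_nonneg_left (hp j).le hcpos (hbd j x hx)

lemma F_left (hp : ∀ i, 0 < p i) (hanti : StrictAnti p) (hsum : HasSum p 1) (i : ℕ) :
    ∃ a, alpha p i < a ∧ a ≤ (alpha p i + alpha p (i + 1)) / 2 ∧ 1 ≤ F p a := by
  have hal := alpha_mono hp hanti hsum (Nat.lt_succ_self i)
  simp only [Nat.succ_eq_add_one] at hal
  set m := (alpha p i + alpha p (i + 1)) / 2 with hm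
  have h0 := lt_one hp hsum 0
  have hi := lt_one hp hsum i
  have hpi := hp i
  set c := (1 - p 0) * (alpha p (i + 1) - m) with hc
  have hcp : 0 < c := mul_pos (by linarith) (by linarith)
  set B := 1 + 1 / c with hB
  have hBp : 0 < B := by positivity
  set e := min (m - alpha p i) (p i / ((1 - p i) * B)) with he
  have hq : 0 < 1 - p i := by linarith
  have hep : 0 < e := lt_min (by linarith) (by positivity)
  refine ⟨alpha p i + e, by linarith, by linarith [min_le_left (m - alpha p i) (p i / ((1 - p i) * B))], ?_⟩
  set a := alpha p i + e with hae
  have ham : a ≤ m := by linarith [min_le_left (m - alpha p i) (p i / ((1 - p i) * B))]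
  have hdi : d p a i = (1 - p i) * e := by rw [alpha_eq hp hsum, hae]; ring
  have hbig : B ≤ p i / d p a i := by
    rw [hdi, le_div_iff₀ (by positivity)]
    have : e ≤ p i / ((1 - p i) * B) := min_le_right _ _
    rw [le_div_iff₀ (by positivity)] at this
    linarith
  have ha0 : a ≠ 0 := by
    have := alpha_neg hp hsum (i + 1)
    intro h; linarith
  have hs1 : HasSum (fun j => -(p j / c) + if j = i then B else 0) (-(1 / c) + B) :=
    ((hsum.div_const c).neg).add (hasSum_ite_eq i B)
  have := hasSum_le (fun j => ?_) hs1 (F_summable hp hsum ha0).hasSum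
  · unfold F; linarith
  · have hpj := hp j
    have hjc : 0 < p j / c := by positivity
    rcases d_sign hp hanti hsum (i := i) (a := a) (b := m) (x := a) ⟨le_refl _, ham⟩ (by linarith) (by linarith) j
      with ⟨hj, h⟩ | ⟨hj, h⟩
    · by_cases hji : j = i
      · subst hji; simp only [if_true]; linarith
      · simp only [hji, if_false]
        have : 0 < (1 - p 0) * (a - alpha p i) := mul_pos (by linarith) (by linarith)
        have : 0 ≤ p j / d p a j := div_nonneg hpj.le (by linarith)
        linarith
    · simp only [hj.ne', if_false, add_zero]
      rw [← div_neg, ]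
      have h' : c ≤ - d p a j := by linarith
      have := div_le_div_of_nonneg_left hpj.le hcp h'
      rw [div_neg] at this ⊢
      linarith

lemma F_right (hp : ∀ i, 0 < p i) (hanti : StrictAnti p) (hsum : HasSum p 1) (i : ℕ) :
    ∃ a, (alpha p i + alpha p (i + 1)) / 2 ≤ a ∧ a < alpha p (i + 1) ∧ F p a ≤ 1 := by
  have hal := alpha_mono hp hanti hsum (Nat.lt_succ_self i)
  simp only [Nat.succ_eq_add_one] at hal
  set m := (alpha p i + alpha p (i + 1)) / 2 with hm
  have h0 := lt_one hp hsum 0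
  have hi := lt_one hp hsum (i + 1)
  have hpi := hp (i + 1)
  set c := (1 - p 0) * (m - alpha p i) with hc
  have hcp : 0 < c := mul_pos (by linarith) (by linarith)
  set B := 1 + 1 / c with hB
  have hBp : 0 < B := by positivity
  have hq : 0 < 1 - p (i + 1) := by linarith
  set e := min (alpha p (i + 1) - m) (p (i + 1) / ((1 - p (i + 1)) * B)) with he
  have hep : 0 < e := lt_min (by linarith) (by positivity)
  have he1 : e ≤ alpha p (i + 1) - m := min_le_left _ _
  refine ⟨alpha p (i + 1) - e, by linarith, by linarith, ?_⟩
  set a := alpha p (i + 1) - e with hae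
  have ham : m ≤ a := by linarith
  have hdi : d p a (i + 1) = - ((1 - p (i + 1)) * e) := by rw [alpha_eq hp hsum, hae]; ring
  have hbig : p (i + 1) / d p a (i + 1) ≤ - B := by
    rw [hdi, div_neg, neg_le_neg_iff, le_div_iff₀ (by positivity)]
    have : e ≤ p (i + 1) / ((1 - p (i + 1)) * B) := min_le_right _ _
    rw [le_div_iff₀ (by positivity)] at this
    linarith
  have ha0 : a ≠ 0 := by
    have := alpha_neg hp hsum (i + 1)
    intro h; linarith
  have hs1 : HasSum (fun j => p j / c + if j = i + 1 then - B else 0) (1 / c + - B) :=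
    (hsum.div_const c).add (hasSum_ite_eq (i + 1) (- B))
  have := hasSum_le (fun j => ?_) (F_summable hp hsum ha0).hasSum hs1
  · unfold F; linarith
  · have hpj := hp j
    have hjc : 0 < p j / c := by positivity
    rcases d_sign hp hanti hsum (i := i) (a := m) (b := a) (x := a) ⟨ham, le_refl _⟩ (by linarith) (by linarith) j
      with ⟨hj, h⟩ | ⟨hj, h⟩
    · have hji : j ≠ i + 1 := by omega
      simp only [hji, if_false, add_zero]
      exact div_le_div_of_nonneg_left hpj.le hcp h
    · by_cases hji : j = i + 1
      · subst hji; simp only [if_true]; linarith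
      · simp only [hji, if_false]
        have : 0 < (1 - p 0) * (alpha p (i + 1) - a) := mul_pos (by linarith) (by linarith)
        have : p j / d p a j ≤ 0 := div_nonpos_of_nonneg_of_nonpos hpj.le (by linarith)
        linarith

lemma eig_unique (hp : ∀ i, 0 < p i) (hanti : StrictAnti p) (hsum : HasSum p 1) (i : ℕ) :
    ∃! x : ℝ, x ∈ Set.Ioo (alpha p i) (alpha p (i + 1)) ∧ Eig p x := by
  obtain ⟨a, ha1, ha2, ha3⟩ := F_left hp hanti hsum i
  obtain ⟨b, hb1, hb2, hb3⟩ := F_right hp hanti hsum i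
  have hneg := alpha_neg hp hsum (i + 1)
  have h0 := lt_one hp hsum 0
  have hsg : ∀ x ∈ Set.Ioo (alpha p i) (alpha p (i + 1)), ∀ j,
      (j ≤ i ∧ 0 < d p x j) ∨ (i < j ∧ d p x j < 0) := by
    intro x hx j
    have h1 : 0 < (1 - p 0) * (x - alpha p i) := mul_pos (by linarith) (by linarith [hx.1])
    have h2 : 0 < (1 - p 0) * (alpha p (i + 1) - x) := mul_pos (by linarith) (by linarith [hx.2])
    rcases d_sign hp hanti hsum (x := x) ⟨le_refl x, le_refl x⟩ hx.1 hx.2 j with ⟨h, h'⟩ | ⟨h, h'⟩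
    · left; exact ⟨h, by linarith⟩
    · right; exact ⟨h, by linarith⟩
  obtain ⟨x, hx, hFx⟩ := intermediate_value_Icc' (ha2.trans hb1) (F_cont hp hanti hsum ha1 hb2)
    (show (1 : ℝ) ∈ _ from ⟨hb3, ha3⟩)
  have hxm : x ∈ Set.Ioo (alpha p i) (alpha p (i + 1)) :=
    ⟨by linarith [hx.1], by linarith [hx.2]⟩
  have hx0 : x ≠ 0 := by linarith [hxm.2] |> fun (h : x < 0) => h.ne
  have uniq : ∀ y z, y ∈ Set.Ioo (alpha p i) (alpha p (i + 1)) →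
      z ∈ Set.Ioo (alpha p i) (alpha p (i + 1)) → F p y = 1 → F p z = 1 → ¬ y < z := by
    intro y z hy hz h1 h2 hlt
    have hy0 : y < 0 := by linarith [hy.2]
    have hz0 : z < 0 := by linarith [hz.2]
    have := F_lt hp hsum hy0.ne hz0.ne hlt (fun j => by
      rcases hsg y hy j with ⟨h, h'⟩ | ⟨h, h'⟩ <;> rcases hsg z hz j with ⟨k, k'⟩ | ⟨k, k'⟩
      · exact mul_pos h' k'
      · omega
      · omega
      · exact mul_pos_of_neg_of_neg h' k')
    linarith
  refine ⟨x, ⟨hxm, (eig_iff hp hanti hsum hx0).2 ⟨fun j => ?_, hFx⟩⟩, ?_⟩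
  · rcases hsg x hxm j with ⟨h, h'⟩ | ⟨h, h'⟩
    · exact h'.ne'
    · exact h'.ne
  · rintro y ⟨hy, hye⟩
    have hy0 : y < 0 := by linarith [hy.2]
    have hFy := ((eig_iff hp hanti hsum hy0.ne).1 hye).2
    exact le_antisymm (not_lt.1 (uniq x y hxm hy hFx hFy)) (not_lt.1 (uniq y x hy hxm hFy hFx))

variable (G : SummableWeightedGraph ℕ)

lemma deg_eq (hp : ∀ i, 0 < p i) (hsum : HasSum p 1)
    (hG : ∀ i j, G.m i j = if i = j then 0 else p i * p j) (v : ℕ) :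
    G.deg v = p v * (1 - p v) := by
  have h1 : HasSum (fun u => p v * p u - if u = v then p v * p v else 0) (p v * 1 - p v * p v) :=
    (hsum.mul_left (p v)).sub (hasSum_ite_eq v _)
  have h2 : (fun u => G.m v u) = fun u => p v * p u - if u = v then p v * p v else 0 := by
    funext u
    rw [hG]
    by_cases h : u = v
    · subst h; simp
    · simp [h, Ne.symm h]
  unfold SummableWeightedGraph.deg
  rw [h2, h1.tsum_eq]; ring

lemma deg_pos (v : ℕ) : 0 < G.deg v := G.noIsolated v

lemma ae_all {Q : ℕ → Prop} (h : ∀ᵐ v ∂G.measure, Q v) (v : ℕ) : Q v := by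
  by_contra hv
  have h1 : G.measure {v} = 0 := measure_mono_null (by simpa using hv) (ae_iff.1 h)
  rw [SummableWeightedGraph.measure, Measure.sum_apply _ (measurableSet_singleton v),
    ENNReal.tsum_eq_zero] at h1
  have := h1 v
  simp [deg_pos G v] at this
  linarith [deg_pos G v]

lemma memLp_iff (hp : ∀ i, 0 < p i) (hanti : StrictAnti p) (hsum : HasSum p 1)
    (hG : ∀ i j, G.m i j = if i = j then 0 else p i * p j) (g : ℕ → ℝ) :
    MemLp g 2 G.measure ↔ Mem p g := by
  rw [memLp_two_iff_integrable_sq (by fun_prop), SummableWeightedGraph.measure,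
    integrable_sum_dirac_iff (fun i => ENNReal.ofReal_ne_top)]
  have : (fun i => (ENNReal.ofReal (G.deg i)).toReal * ‖g i ^ 2‖)
      = fun i => (1 - p i) * (p i * g i ^ 2) := by
    funext i
    rw [ENNReal.toReal_ofReal (deg_pos G i).le, deg_eq G hp hsum hG, Real.norm_eq_abs,
      abs_of_nonneg (sq_nonneg _)]
    ring
  rw [this]
  constructor
  · intro h
    have h0 := lt_one hp hsum 0
    refine Summable.of_nonneg_of_le (fun v => by have := hp v; positivity) (fun v => ?_)
      (h.mul_left (1 - p 0)⁻¹)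
    rw [← div_eq_inv_mul, le_div_iff₀ (by linarith)]
    have := mul_nonneg (hp v).le (sq_nonneg (g v))
    have h2 : p v ≤ p 0 := hanti.antitone (Nat.zero_le v)
    nlinarith
  · intro h
    refine Summable.of_nonneg_of_le (fun v => ?_) (fun v => ?_) h
    · have := lt_one hp hsum v
      exact mul_nonneg (by linarith) (mul_nonneg (hp v).le (sq_nonneg (g v)))
    · have := mul_nonneg (hp v).le (mul_nonneg (hp v).le (sq_nonneg (g v)))
      linarith

lemma P_eq (hp : ∀ i, 0 < p i) (hsum : HasSum p 1)
    (hG : ∀ i j, G.m i j = if i = j then 0 else p i * p j) {f : ℕ → ℝ} (hf : Mem p f) (v : ℕ) :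
    (G.deg v)⁻¹ * ∑' u, G.m v u * f u = (∑' u, p u * f u - p v * f v) / (1 - p v) := by
  have h1 : HasSum (fun u => p v * (p u * f u) - if u = v then p v * (p v * f v) else 0)
      (p v * (∑' u, p u * f u) - p v * (p v * f v)) :=
    ((hf.summable hp hsum).hasSum.mul_left (p v)).sub (hasSum_ite_eq v _)
  have h2 : (fun u => G.m v u * f u)
      = fun u => p v * (p u * f u) - if u = v then p v * (p v * f v) else 0 := by
    funext u
    rw [hG]
    by_cases h : u = v
    · subst h; simp
    · simp [h, Ne.symm h]; ring
  rw [h2, h1.tsum_eq, deg_eq G hp hsum hG]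
  have := (hp v).ne'
  have : 1 - p v ≠ 0 := by linarith [lt_one hp hsum v]
  field_simp

lemma eigen_iff (hp : ∀ i, 0 < p i) (hanti : StrictAnti p) (hsum : HasSum p 1)
    (hG : ∀ i j, G.m i j = if i = j then 0 else p i * p j)
    (P : Lp ℝ 2 G.measure →L[ℝ] Lp ℝ 2 G.measure)
    (hP : ∀ f : Lp ℝ 2 G.measure, ∀ᵐ v ∂G.measure,
      P f v = (G.deg v)⁻¹ * ∑' u, G.m v u * f u) (x : ℝ) :
    IsEigenvalue P x ↔ Eig p x := by
  have hM := memLp_iff G hp hanti hsum hG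
  constructor
  · rintro ⟨f, hf, h⟩
    have hfm : Mem p f := (hM f).1 (Lp.memLp f)
    refine ⟨f, hfm, fun h0 => hf ?_, fun v => ?_⟩
    · refine Lp.ext (Filter.Eventually.of_forall fun v => ?_)
      rw [h0]
      exact (ae_all G (Lp.coeFn_zero ℝ 2 G.measure) v).symm
    · have h1 := ae_all G (hP f) v
      rw [P_eq G hp hsum hG hfm, h, ae_all G (Lp.coeFn_smul x f) v] at h1
      exact h1.symm
  · rintro ⟨g, hg, hne, h⟩
    have hco : ∀ v, ((hM g).2 hg).toLp g v = g v := ae_all G ((hM g).2 hg).coeFn_toLp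
    have hco' : (((hM g).2 hg).toLp g : ℕ → ℝ) = g := funext hco
    refine ⟨((hM g).2 hg).toLp g, fun h0 => hne ?_, ?_⟩
    · funext v
      rw [← hco v, h0]
      exact ae_all G (Lp.coeFn_zero _ _ _) v
    · refine Lp.ext (Filter.Eventually.of_forall fun v => ?_)
      rw [ae_all G (hP _) v, ae_all G (Lp.coeFn_smul x _) v, Pi.smul_apply, hco', P_eq G hp hsum hG hg, h v]
      rfl

lemma spec (hp : ∀ i, 0 < p i) (hanti : StrictAnti p) (hsum : HasSum p 1)
    (hG : ∀ i j, G.m i j = if i = j then 0 else p i * p j)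
    (P : Lp ℝ 2 G.measure →L[ℝ] Lp ℝ 2 G.measure)
    (hP : ∀ f : Lp ℝ 2 G.measure, ∀ᵐ v ∂G.measure,
      P f v = (G.deg v)⁻¹ * ∑' u, G.m v u * f u) (x : ℝ) (hx : x ≠ 0) (hxs : x ∈ spectrum ℝ P) :
    IsEigenvalue P x := by
  by_contra hn
  have hM := memLp_iff G hp hanti hsum hG
  rw [spectrum.mem_iff, IsUnit.sub_iff, ContinuousLinearMap.isUnit_iff_bijective] at hxs
  have happ : ∀ f, (P - algebraMap ℝ (Lp ℝ 2 G.measure →L[ℝ] Lp ℝ 2 G.measure) x) f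
      = P f - x • f := fun f => by simp [Algebra.algebraMap_eq_smul_one]
  apply hxs
  constructor
  · rw [injective_iff_map_eq_zero]
    intro f hf
    rw [happ, sub_eq_zero] at hf
    by_contra h0
    exact hn ⟨f, h0, hf⟩
  · intro g
    rw [eigen_iff G hp hanti hsum hG P hP] at hn
    obtain ⟨f, hf, h⟩ := surj hp hanti hsum hx hn ((hM g).1 (Lp.memLp g))
    have hco : (((hM f).2 hf).toLp f : ℕ → ℝ) = f :=
      funext (ae_all G ((hM f).2 hf).coeFn_toLp)
    refine ⟨((hM f).2 hf).toLp f, ?_⟩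
    rw [happ]
    refine Lp.ext (Filter.Eventually.of_forall fun v => ?_)
    rw [ae_all G (Lp.coeFn_sub _ _) v, Pi.sub_apply, ae_all G (hP _) v,
      ae_all G (Lp.coeFn_smul x _) v, Pi.smul_apply, hco, P_eq G hp hsum hG hf, ← h v]
    rfl

lemma eigen_mem {H : Type*} [NormedAddCommGroup H] [NormedSpace ℝ H] 
    (T : H →L[ℝ] H) (x : ℝ) (h : IsEigenvalue T x) : x ∈ spectrum ℝ T := by
  obtain ⟨f, hf, h⟩ := h
  rw [spectrum.mem_iff]
  rintro ⟨u, hu⟩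
  apply hf
  have h1 : (u : H →L[ℝ] H) f = 0 := by
    rw [hu]; simp [Algebra.algebraMap_eq_smul_one, h]
  have h2 : ((↑u⁻¹ : H →L[ℝ] H) * (u : H →L[ℝ] H)) f = 0 := by
    rw [ContinuousLinearMap.mul_apply, h1, map_zero]
  simpa using h2

end RW

open SummableWeightedGraph in
/-- the spectrum of the random-walk operator of the infinite complete
graph with pairwise distinct decreasing weights. -/
theorem spectrum_random_walk_complete_graph (p : ℕ → ℝ) (hp : ∀ i, 0 < p i)
    (hanti : StrictAnti p) (hsum : HasSum p 1) (G : SummableWeightedGraph ℕ)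
    (hG : ∀ i j, G.m i j = if i = j then 0 else p i * p j)
    (P : Lp ℝ 2 G.measure →L[ℝ] Lp ℝ 2 G.measure)
    (hP : ∀ f : Lp ℝ 2 G.measure, ∀ᵐ v ∂G.measure,
      P f v = (G.deg v)⁻¹ * ∑' u, G.m v u * f u) :
    IsEigenvalue P 1 ∧
    (∀ lam : ℝ, 0 < lam → IsEigenvalue P lam → lam = 1) ∧
    (∀ lam : ℝ, IsEigenvalue P lam → lam ≠ 1 → lam < 0) ∧
    (∀ i : ℕ, ∃! lam : ℝ,
      lam ∈ Set.Ioo (alpha p i) (alpha p (i + 1)) ∧ IsEigenvalue P lam) ∧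
    (∀ lam : ℝ, lam < 0 → IsEigenvalue P lam →
      ∃ i : ℕ, lam ∈ Set.Ioo (alpha p i) (alpha p (i + 1))) ∧
    (0 : ℝ) ∈ spectrum ℝ P ∧
    (0 : ℝ) ∈ closure {lam : ℝ | IsEigenvalue P lam ∧ lam ≠ 0} ∧
    ¬ IsEigenvalue P 0 ∧
    (∀ x ∈ spectrum ℝ P, x ≠ 0 → IsEigenvalue P x) ∧
    spectrum ℝ P = ({0, 1} : Set ℝ) ∪ {lam : ℝ | lam < 0 ∧ IsEigenvalue P lam} := by
  have hE := RW.eigen_iff G hp hanti hsum hG P hP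
  have hspec := RW.spec G hp hanti hsum hG P hP
  have h1 : IsEigenvalue P 1 := (hE 1).2 (RW.eig_one hp hanti hsum)
  have hpos : ∀ lam : ℝ, 0 < lam → IsEigenvalue P lam → lam = 1 :=
    fun x hx h => RW.eig_pos hp hanti hsum hx ((hE x).1 h)
  have hzero : ¬ IsEigenvalue P 0 := fun h => RW.eig_zero hp hsum ((hE 0).1 h)
  have hneg : ∀ lam : ℝ, IsEigenvalue P lam → lam ≠ 1 → lam < 0 := by
    intro x h hx
    rcases lt_trichotomy x 0 with h' | h' | h'
    · exact h'
    · subst h'; exact absurd h hzero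
    · exact absurd (hpos x h' h) hx
  have hun : ∀ i : ℕ, ∃! lam : ℝ,
      lam ∈ Set.Ioo (alpha p i) (alpha p (i + 1)) ∧ IsEigenvalue P lam := by
    intro i
    simp only [hE]
    exact RW.eig_unique hp hanti hsum i
  have hcl : (0 : ℝ) ∈ closure {lam : ℝ | IsEigenvalue P lam ∧ lam ≠ 0} := by
    choose l hl using fun i => (hun i).exists
    have ht := RW.alpha_tendsto hsum
    have hlt : Filter.Tendsto l Filter.atTop (nhds 0) :=
      tendsto_of_tendsto_of_tendsto_of_le_of_le ht (ht.comp (Filter.tendsto_add_atTop_nat 1))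
        (fun i => (hl i).1.1.le) (fun i => (hl i).1.2.le)
    refine mem_closure_of_tendsto hlt (Filter.Eventually.of_forall fun i => ⟨(hl i).2, ?_⟩)
    intro h
    have := (hl i).2
    rw [h] at this
    exact hzero this
  have h0s : (0 : ℝ) ∈ spectrum ℝ P := by
    refine closure_minimal ?_ (spectrum.isClosed P) hcl
    rintro x ⟨hx, _⟩
    exact RW.eigen_mem P x hx
  refine ⟨h1, hpos, hneg, hun, fun x hx h => RW.eig_neg hp hanti hsum hx ((hE x).1 h), h0s, hcl,
    hzero, fun x hxs hx => hspec x hx hxs, ?_⟩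
  ext x
  constructor
  · intro hx
    by_cases hx0 : x = 0
    · left; simp [hx0]
    · by_cases hx1 : x = 1
      · left; simp [hx1]
      · right
        have := hspec x hx0 hx
        exact ⟨hneg x this hx1, this⟩
  · rintro (h | h)
    · rcases h with h | h
      · rw [h]; exact h0s
      · rw [Set.mem_singleton_iff.1 h]; exact RW.eigen_mem P 1 h1
    · exact RW.eigen_mem P x h.2
end

section
/- Let (K,m) be the infinite complete graph with weights m(i,j) = p_i·p_j, where p_1 > p_2 > … > 0 and ∑ p_i = 1, and let Δ = I − P be its normalised Laplacian. Then: the point 1 belongs to σ(Δ) as an accumulation point and is the only point of σ(Δ) that is not an eigenvalue; all other points of σ(Δ) are simple eigenvalues; 0 is the unique eigenvalue of Δ in the interval [0,1); the remaining eigenvalues form a strictly decreasing sequence … < μ_3 < μ_2 < μ_1 ≤ 2 lying in (1,2), with exactly one eigenvalue μ_i in each interval (1/q_{i+1}, 1/q_i) for i = 1,2,…, so that μ_i → 1. Consequently the spectral gap satisfies λ_gap(Δ) = 1, and the top of the spectrum λ_top(Δ) = μ_1 satisfies 1/q_2 < μ_1 < 1/q_1. -/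
open MeasureTheory

open MeasureTheory Filter Topology

noncomputable def tt (p : ℕ → ℝ) (x : ℝ) (i : ℕ) : ℝ := p i * (1 - p i) * (1 - x * (1 - p i))⁻¹

noncomputable def HH (p : ℕ → ℝ) (x : ℝ) : ℝ := ∑' i, tt p x i

section real
variable {p : ℕ → ℝ}

lemma pair_le (hp : ∀ i, 0 < p i) (hsum : HasSum p 1) {i j : ℕ} (h : i ≠ j) : p i + p j ≤ 1 := by
  have := sum_le_hasSum {i, j} (fun k _ => (hp k).le) hsum
  rwa [Finset.sum_pair h] at this

lemma q_pos (hp : ∀ i, 0 < p i) (hsum : HasSum p 1) (i : ℕ) : 0 < 1 - p i := by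
  have := pair_le hp hsum (Nat.succ_ne_self i).symm
  have := hp (i+1)
  linarith

lemma inv_bdd (hsum : HasSum p 1) {x : ℝ} (hx : x ≠ 1) :
    ∃ C : ℝ, ∀ i, |(1 - x * (1 - p i))⁻¹| ≤ C := by
  have h0 : Tendsto p atTop (𝓝 0) := hsum.summable.tendsto_atTop_zero
  have h1 : Tendsto (fun i => (1 - x * (1 - p i))) atTop (𝓝 (1 - x * (1 - 0))) :=
    ((h0.const_sub 1).const_mul x).const_sub 1
  have h2 := (h1.inv₀ (by intro h; apply hx; linarith)).abs
  obtain ⟨C, hC⟩ := h2.bddAbove_range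
  exact ⟨C, fun i => hC ⟨i, rfl⟩⟩

lemma summ_inv (hp : ∀ i, 0 < p i) (hsum : HasSum p 1) {x : ℝ} (hx : x ≠ 1) :
    Summable (fun i => p i * (1 - x * (1 - p i))⁻¹) := by
  obtain ⟨C, hC⟩ := inv_bdd hsum hx
  refine Summable.of_norm_bounded (hsum.summable.mul_right C) (fun i => ?_)
  rw [norm_mul, Real.norm_eq_abs, Real.norm_eq_abs, abs_of_pos (hp i)]
  exact mul_le_mul_of_nonneg_left (hC i) (hp i).le

lemma summ_tt (hp : ∀ i, 0 < p i) (hsum : HasSum p 1) {x : ℝ} (hx : x ≠ 1) :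
    Summable (tt p x) := by
  refine Summable.of_norm_bounded (summ_inv hp hsum hx).norm (fun i => ?_)
  have := q_pos hp hsum i
  have h1 := hp i
  unfold tt
  rw [mul_right_comm, norm_mul _ (1 - p i), Real.norm_eq_abs (1 - p i), abs_of_pos this]
  exact mul_le_of_le_one_right (norm_nonneg _) (by linarith)

lemma F_eq (hp : ∀ i, 0 < p i) (hsum : HasSum p 1) {x : ℝ} (hx : x ≠ 1)
    (hne : ∀ i, 1 - x * (1 - p i) ≠ 0) :
    ∑' i, p i * (1 - x * (1 - p i))⁻¹ = 1 + x * HH p x := by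
  unfold HH
  have h1 := hsum.add ((summ_tt hp hsum hx).mul_left x).hasSum
  rw [tsum_mul_left] at h1
  rw [← h1.tsum_eq]
  congr 1
  ext i
  have := hne i
  unfold tt
  field_simp
  ring

/-- the interval -/
def II (p : ℕ → ℝ) (k : ℕ) : Set ℝ := Set.Ioo ((1 - p (k + 1))⁻¹) ((1 - p k)⁻¹)

lemma II_bd (hp : ∀ i, 0 < p i) (hsum : HasSum p 1) {k : ℕ} {x : ℝ} :
    x ∈ II p k ↔ 1 < x * (1 - p (k+1)) ∧ x * (1 - p k) < 1 := by
  have h1 := q_pos hp hsum k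
  have h2 := q_pos hp hsum (k+1)
  unfold II
  rw [Set.mem_Ioo, inv_lt_iff_one_lt_mul₀ h2, ← one_div, lt_div_iff₀ h1]

lemma II_gt (hp : ∀ i, 0 < p i) (hsum : HasSum p 1) {k : ℕ} {x : ℝ} (hx : x ∈ II p k) : 1 < x := by
  have h := (II_bd hp hsum).1 hx
  have h2 := q_pos hp hsum (k+1)
  have h3 := hp (k+1)
  nlinarith

lemma II_lo (hp : ∀ i, 0 < p i) (hanti : StrictAnti p) (hsum : HasSum p 1) {k : ℕ} {x : ℝ}
    (hx : x ∈ II p k) {i : ℕ} (hi : i ≤ k) : 0 < 1 - x * (1 - p i) := by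
  have h := (II_bd hp hsum).1 hx
  have h1 := II_gt hp hsum hx
  have h2 : p k ≤ p i := hanti.antitone hi
  nlinarith

lemma II_hi (hp : ∀ i, 0 < p i) (hanti : StrictAnti p) (hsum : HasSum p 1) {k : ℕ} {x : ℝ}
    (hx : x ∈ II p k) {i : ℕ} (hi : k < i) : 1 - x * (1 - p i) < 0 := by
  have h := (II_bd hp hsum).1 hx
  have h1 := II_gt hp hsum hx
  have h2 : p i ≤ p (k+1) := hanti.antitone hi
  nlinarith

lemma II_ne (hp : ∀ i, 0 < p i) (hanti : StrictAnti p) (hsum : HasSum p 1) {k : ℕ} {x : ℝ}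
    (hx : x ∈ II p k) (i : ℕ) : 1 - x * (1 - p i) ≠ 0 := by
  rcases le_or_gt i k with h | h
  · exact (II_lo hp hanti hsum hx h).ne'
  · exact (II_hi hp hanti hsum hx h).ne

lemma tt_lt (hp : ∀ i, 0 < p i) (hanti : StrictAnti p) (hsum : HasSum p 1) {k : ℕ} {x y : ℝ}
    (hx : x ∈ II p k) (hy : y ∈ II p k) (hxy : x < y) (i : ℕ) : tt p x i < tt p y i := by
  have h2 := q_pos hp hsum i
  unfold tt
  refine mul_lt_mul_of_pos_left ?_ (mul_pos (hp i) h2)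
  rcases le_or_gt i k with h | h
  · rw [inv_lt_inv₀ (II_lo hp hanti hsum hx h) (II_lo hp hanti hsum hy h)]
    nlinarith
  · rw [inv_lt_inv_of_neg (II_hi hp hanti hsum hx h) (II_hi hp hanti hsum hy h)]
    nlinarith

lemma tt_le (hp : ∀ i, 0 < p i) (hanti : StrictAnti p) (hsum : HasSum p 1) {k : ℕ} {x y : ℝ}
    (hx : x ∈ II p k) (hy : y ∈ II p k) (hxy : x ≤ y) (i : ℕ) : tt p x i ≤ tt p y i := by
  rcases hxy.eq_or_lt with rfl | h
  · exact le_rfl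
  · exact (tt_lt hp hanti hsum hx hy h i).le

lemma HH_diff (hp : ∀ i, 0 < p i) (hanti : StrictAnti p) (hsum : HasSum p 1) {k : ℕ} {x y : ℝ}
    (hx : x ∈ II p k) (hy : y ∈ II p k) (hxy : x ≤ y) (i : ℕ) :
    tt p y i - tt p x i ≤ HH p y - HH p x := by
  have sx := summ_tt hp hsum (II_gt hp hsum hx).ne'
  have sy := summ_tt hp hsum (II_gt hp hsum hy).ne'
  unfold HH
  rw [← sy.tsum_sub sx]
  refine (sy.sub sx).le_tsum i (fun j _ => ?_)
  exact sub_nonneg.2 (tt_le hp hanti hsum hx hy hxy j)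

lemma HH_cont (hp : ∀ i, 0 < p i) (hanti : StrictAnti p) (hsum : HasSum p 1) {k : ℕ} {x y : ℝ}
    (hx : x ∈ II p k) (hy : y ∈ II p k) : ContinuousOn (HH p) (Set.Icc x y) := by
  have sx := summ_tt hp hsum (II_gt hp hsum hx).ne'
  have sy := summ_tt hp hsum (II_gt hp hsum hy).ne'
  have hm : ∀ z ∈ Set.Icc x y, z ∈ II p k := fun z hz =>
    ⟨hx.1.trans_le hz.1, hz.2.trans_lt hy.2⟩
  unfold HH
  refine continuousOn_tsum (u := fun i => |tt p x i| + |tt p y i|) (fun i => ?_)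
    (sx.abs.add sy.abs) (fun i z hz => ?_)
  · unfold tt
    refine ContinuousOn.mul continuousOn_const (ContinuousOn.inv₀ (by fun_prop) ?_)
    intro z hz
    exact II_ne hp hanti hsum (hm z hz) i
  · have h1 := tt_le hp hanti hsum hx (hm z hz) hz.1 i
    have h2 := tt_le hp hanti hsum (hm z hz) hy hz.2 i
    rw [Real.norm_eq_abs, abs_le]
    have := neg_abs_le (tt p x i)
    have := le_abs_self (tt p y i)
    have := abs_nonneg (tt p x i)
    have := abs_nonneg (tt p y i)
    constructor <;> linarith

lemma II_nonempty (hp : ∀ i, 0 < p i) (hanti : StrictAnti p) (hsum : HasSum p 1) (k : ℕ) :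
    ∃ b, b ∈ II p k := by
  apply Set.nonempty_Ioo.2
  have := hanti (Nat.lt_succ_self k)
  exact (inv_lt_inv₀ (q_pos hp hsum _) (q_pos hp hsum _)).2 (by simp only [Nat.succ_eq_add_one] at this; linarith)

lemma HH_neg (hp : ∀ i, 0 < p i) (hanti : StrictAnti p) (hsum : HasSum p 1) {k : ℕ} {b : ℝ}
    (hb : b ∈ II p k) : ∃ a ∈ II p k, a ≤ b ∧ HH p a < 0 := by
  have hq := q_pos hp hsum (k+1)
  have hpq := mul_pos (hp (k+1)) hq
  have hn := II_hi hp hanti hsum hb (Nat.lt_succ_self k)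
  simp only [Nat.succ_eq_add_one] at hn
  obtain ⟨M, hM1, hM2⟩ : ∃ M, - tt p b (k+1) ≤ M ∧ HH p b + 1 - tt p b (k+1) ≤ M :=
    ⟨max _ _, le_max_left _ _, le_max_right _ _⟩
  have ht : 0 < - tt p b (k+1) := by
    unfold tt
    rw [← mul_neg]
    exact mul_pos hpq (neg_pos.2 (inv_lt_zero.2 hn))
  have hM : 0 < M := ht.trans_le hM1
  set a := (1 + p (k+1) * (1 - p (k+1)) / M) / (1 - p (k+1)) with ha
  have e : 1 - a * (1 - p (k+1)) = - (p (k+1) * (1 - p (k+1)) / M) := by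
    rw [ha]; field_simp; ring
  have hta : tt p a (k+1) = - M := by
    unfold tt; rw [e]; 
    have := (hp (k+1)).ne'
    field_simp
  have hdiv := div_pos hpq hM
  have hab : a ≤ b := by
    rw [ha, div_le_iff₀ hq]
    have : p (k+1) * (1 - p (k+1)) / M ≤ -(1 - b * (1 - p (k+1))) := by
      rw [div_le_iff₀ hM]
      have : p (k+1) * (1 - p (k+1)) = -(1 - b * (1 - p (k+1))) * (- tt p b (k+1)) := by
        unfold tt
        have := hn.ne
        generalize 1 - b * (1 - p (k+1)) = D at *
        field_simp
      rw [this]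
      exact mul_le_mul_of_nonneg_left hM1 (by linarith)
    linarith
  have haI : a ∈ II p k := by
    refine ⟨?_, hab.trans_lt hb.2⟩
    rw [inv_lt_iff_one_lt_mul₀ hq]
    linarith
  refine ⟨a, haI, hab, ?_⟩
  have := HH_diff hp hanti hsum haI hb hab (k+1)
  linarith

lemma HH_pos (hp : ∀ i, 0 < p i) (hanti : StrictAnti p) (hsum : HasSum p 1) {k : ℕ} {b : ℝ}
    (hb : b ∈ II p k) : ∃ a ∈ II p k, b ≤ a ∧ 0 < HH p a := by
  have hq := q_pos hp hsum k
  have hpq := mul_pos (hp k) hq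
  have hn := II_lo hp hanti hsum hb le_rfl
  obtain ⟨M, hM1, hM2⟩ : ∃ M, tt p b k ≤ M ∧ 1 - HH p b + tt p b k ≤ M :=
    ⟨max _ _, le_max_left _ _, le_max_right _ _⟩
  have ht : 0 < tt p b k := by
    unfold tt
    exact mul_pos hpq (inv_pos.2 hn)
  have hM : 0 < M := ht.trans_le hM1
  set a := (1 - p k * (1 - p k) / M) / (1 - p k) with ha
  have e : 1 - a * (1 - p k) = (p k * (1 - p k) / M) := by
    rw [ha]; field_simp; ring
  have hta : tt p a k = M := by
    unfold tt; rw [e]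
    have := (hp k).ne'
    field_simp
  have hdiv := div_pos hpq hM
  have hab : b ≤ a := by
    rw [ha, le_div_iff₀ hq]
    have : p k * (1 - p k) / M ≤ (1 - b * (1 - p k)) := by
      rw [div_le_iff₀ hM]
      have : p k * (1 - p k) = (1 - b * (1 - p k)) * (tt p b k) := by
        unfold tt
        have := hn.ne'
        generalize 1 - b * (1 - p k) = D at *
        field_simp
      rw [this]
      exact mul_le_mul_of_nonneg_left hM1 (by linarith)
    linarith
  have haI : a ∈ II p k := by
    refine ⟨hb.1.trans_le hab, ?_⟩
    rw [← one_div, lt_div_iff₀ hq]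
    linarith
  refine ⟨a, haI, hab, ?_⟩
  have := HH_diff hp hanti hsum hb haI hab k
  linarith

lemma HH_zero (hp : ∀ i, 0 < p i) (hanti : StrictAnti p) (hsum : HasSum p 1) (k : ℕ) :
    ∃ x ∈ II p k, HH p x = 0 := by
  obtain ⟨b, hb⟩ := II_nonempty hp hanti hsum k
  obtain ⟨a, ha, hab, ha0⟩ := HH_neg hp hanti hsum hb
  obtain ⟨c, hc, hbc, hc0⟩ := HH_pos hp hanti hsum hb
  obtain ⟨x, hx, hx0⟩ := intermediate_value_Icc (hab.trans hbc) (HH_cont hp hanti hsum ha hc)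
    ⟨ha0.le, hc0.le⟩
  exact ⟨x, ⟨ha.1.trans_le hx.1, hx.2.trans_lt hc.2⟩, hx0⟩

lemma HH_uniq (hp : ∀ i, 0 < p i) (hanti : StrictAnti p) (hsum : HasSum p 1) {k : ℕ} {x y : ℝ}
    (hx : x ∈ II p k) (hy : y ∈ II p k) (h : HH p x = HH p y) : x = y := by
  rcases lt_trichotomy x y with l | l | l
  · have := HH_diff hp hanti hsum hx hy l.le 0
    have := tt_lt hp hanti hsum hx hy l 0
    linarith
  · exact l
  · have := HH_diff hp hanti hsum hy hx l.le 0
    have := tt_lt hp hanti hsum hy hx l 0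
    linarith

lemma HH_loc (hp : ∀ i, 0 < p i) (hanti : StrictAnti p) (hsum : HasSum p 1) {x : ℝ} (hx : x ≠ 1)
    (hne : ∀ i, 1 - x * (1 - p i) ≠ 0) (h0 : HH p x = 0) : ∃ k, x ∈ II p k := by
  have sx := summ_tt hp hsum hx
  rcases lt_or_gt_of_ne hx with h | h
  · exfalso
    have hpos : ∀ i, 0 < tt p x i := by
      intro i
      have h1 := q_pos hp hsum i
      have := hp i
      exact mul_pos (mul_pos this h1) (inv_pos.2 (by nlinarith))
    have := sx.tsum_pos (fun i => (hpos i).le) 0 (hpos 0)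
    unfold HH at h0
    linarith
  · have hex : ∃ n, 1 < x * (1 - p n) := by
      have h1 : Tendsto (fun i => x * (1 - p i)) atTop (𝓝 (x * (1 - 0))) :=
        (hsum.summable.tendsto_atTop_zero.const_sub 1).const_mul x
      exact (h1.eventually_const_lt (by linarith)).exists
    classical
    rcases hn : Nat.find hex with _ | k
    · exfalso
      have h2 := Nat.find_spec hex
      rw [hn] at h2
      have hneg : ∀ i, 0 < - tt p x i := by
        intro i
        have h1 := q_pos hp hsum i
        have h3 := hp i
        have h4 : p i ≤ p 0 := hanti.antitone (Nat.zero_le i)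
        unfold tt
        rw [← mul_neg]
        exact mul_pos (mul_pos h3 h1) (neg_pos.2 (inv_lt_zero.2 (by nlinarith)))
      have := sx.neg.tsum_pos (fun i => (hneg i).le) 0 (hneg 0)
      rw [tsum_neg] at this
      unfold HH at h0
      linarith
    · refine ⟨k, (II_bd hp hsum).2 ⟨?_, ?_⟩⟩
      · have h2 := Nat.find_spec hex
        rwa [hn] at h2
      · have h2 := Nat.find_min hex (m := k) (by omega)
        have h3 := hne k
        exact lt_of_le_of_ne (not_lt.1 h2) (fun h => h3 (by linarith))

lemma HH_two (hp : ∀ i, 0 < p i) (hanti : StrictAnti p) (hsum : HasSum p 1) {x : ℝ} {k : ℕ}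
    (hx : x ∈ II p k) (h0 : HH p x = 0) : x ≤ 2 := by
  have hb := (II_bd hp hsum).1 hx
  have hx1 := II_gt hp hsum hx
  by_contra! h2
  rcases k with _ | k
  · have sx := summ_tt hp hsum hx1.ne'
    have hq := q_pos hp hsum 0
    have hA : 1 < x * p 0 := by nlinarith
    have s1 : HasSum (fun i => p (i+1)) (1 - p 0) := by
      rw [hasSum_nat_add_iff 1]; simpa using hsum
    have hle : ∀ i, - (p 0 * (x * p 0 - 1)⁻¹) * p (i+1) ≤ tt p x (i+1) := by
      intro i
      have h3 := pair_le hp hsum (Nat.succ_ne_zero i)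
      simp only [Nat.succ_eq_add_one] at h3
      have h4 := II_hi hp hanti hsum hx (Nat.succ_pos i)
      simp only [Nat.succ_eq_add_one] at h4
      have h5 := hp (i+1)
      have h6 : tt p x (i+1) = - ((1 - p (i+1)) * (x * (1 - p (i+1)) - 1)⁻¹) * p (i+1) := by
        unfold tt
        rw [← neg_sub 1 (x * _), inv_neg]
        ring
      rw [h6]
      refine mul_le_mul_of_nonneg_right (neg_le_neg ?_) h5.le
      rw [← div_eq_mul_inv, ← div_eq_mul_inv, div_le_div_iff₀ (by linarith) (by linarith)]
      nlinarith
    have h7 := (((summable_nat_add_iff 1).2 sx)).hasSum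
    have h8 := hasSum_le hle (s1.mul_left _) h7
    unfold HH at h0
    rw [sx.tsum_eq_zero_add] at h0
    have h9 : p 0 * (1 - p 0) * (x * p 0 - 1)⁻¹ < tt p x 0 := by
      unfold tt
      refine mul_lt_mul_of_pos_left ?_ (mul_pos (hp 0) hq)
      rw [inv_lt_inv₀] <;> simp only [zero_add] at hb <;> linarith
    nlinarith
  · have h1 := pair_le hp hsum (i := 0) (j := k+1) (by omega)
    have h3 := hanti (Nat.succ_pos k)
    simp only [Nat.succ_eq_add_one] at h3
    nlinarith
end real

section graph
open SummableWeightedGraph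
variable {p : ℕ → ℝ} {G : SummableWeightedGraph ℕ}

lemma deg_eq (hsum : HasSum p 1)
    (hG : ∀ i j, G.m i j = if i = j then 0 else p i * p j) (i : ℕ) :
    G.deg i = p i * (1 - p i) := by
  unfold SummableWeightedGraph.deg
  have h1 := (hsum.mul_left (p i)).sub (hasSum_ite_eq i (p i * p i))
  have h2 : (fun j => p i * p j - if j = i then p i * p i else 0) = fun j => G.m i j := by
    ext j
    rw [hG]
    by_cases h : i = j
    · subst h; simp
    · simp [h, Ne.symm h]
  rw [h2] at h1
  rw [h1.tsum_eq]; ring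

lemma ae_all (G : SummableWeightedGraph ℕ) {P : ℕ → Prop} :
    (∀ᵐ v ∂G.measure, P v) ↔ ∀ v, P v := by
  unfold SummableWeightedGraph.measure
  rw [Measure.ae_sum_iff]
  refine forall_congr' fun v => ?_
  have h : ENNReal.ofReal (G.deg v) ≠ 0 := by
    have := G.noIsolated v
    simpa [SummableWeightedGraph.deg] using this
  rw [Measure.ae_ennreal_smul_measure_eq h, ae_dirac_eq]
  simp

lemma fin_meas (hp : ∀ i, 0 < p i) (hsum : HasSum p 1)
    (hG : ∀ i j, G.m i j = if i = j then 0 else p i * p j) : IsFiniteMeasure G.measure := by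
  constructor
  unfold SummableWeightedGraph.measure
  rw [Measure.sum_apply _ MeasurableSet.univ]
  simp only [Measure.smul_apply, measure_univ, smul_eq_mul, mul_one]
  have hs : Summable G.deg := by
    refine Summable.of_nonneg_of_le (fun i => ?_) (fun i => ?_) hsum.summable
    · rw [deg_eq hsum hG]; exact (mul_pos (hp i) (q_pos hp hsum i)).le
    · rw [deg_eq hsum hG]; nlinarith [hp i]
  rw [← ENNReal.ofReal_tsum_of_nonneg _ hs]
  · exact ENNReal.ofReal_lt_top
  · intro i
    rw [deg_eq hsum hG]; exact (mul_pos (hp i) (q_pos hp hsum i)).le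

lemma meas_any (G : SummableWeightedGraph ℕ) (f : ℕ → ℝ) : AEStronglyMeasurable f G.measure :=
  (Measurable.of_discrete).aestronglyMeasurable

lemma summ_L2 (hp : ∀ i, 0 < p i) (hanti : StrictAnti p) (hsum : HasSum p 1)
    (hG : ∀ i j, G.m i j = if i = j then 0 else p i * p j) {f : ℕ → ℝ}
    (hf : MemLp f 2 G.measure) : Summable (fun i => p i * f i) := by
  have := fin_meas hp hsum hG
  have h1 : Integrable f G.measure := hf.integrable (by norm_num)
  have h2 := (hasSum_integral_measure h1).summable
  simp only [integral_smul_measure, integral_dirac, smul_eq_mul] at h2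
  refine Summable.of_norm_bounded (h2.norm.mul_right (1 - p 0)⁻¹) (fun i => ?_)
  have hq := q_pos hp hsum i
  have hq0 := q_pos hp hsum 0
  have hpi := hp i
  rw [ENNReal.toReal_ofReal (by rw [deg_eq hsum hG]; positivity), deg_eq hsum hG, norm_mul, norm_mul,
    norm_mul, Real.norm_of_nonneg hq.le, mul_right_comm (‖p i‖), mul_assoc]
  refine le_mul_of_one_le_right (by positivity) ?_
  rw [← div_eq_mul_inv, one_le_div hq0]
  linarith [hanti.antitone (Nat.zero_le i)]

lemma memLp_mul {f h : ℕ → ℝ} (hf : MemLp f 2 G.measure) {C : ℝ} (hC : ∀ i, |h i| ≤ C) :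
    MemLp (fun i => f i * h i) 2 G.measure := by
  refine hf.of_le_mul (c := C) (meas_any G _) ((ae_all G).2 fun i => ?_)
  rw [norm_mul, mul_comm]
  exact mul_le_mul_of_nonneg_right (hC i) (norm_nonneg _)

lemma lap_apply (hp : ∀ i, 0 < p i) (hanti : StrictAnti p) (hsum : HasSum p 1)
    (hG : ∀ i j, G.m i j = if i = j then 0 else p i * p j)
    {Δ : Lp ℝ 2 G.measure →L[ℝ] Lp ℝ 2 G.measure} (hΔ : G.IsLaplacian Δ)
    (f : Lp ℝ 2 G.measure) (i : ℕ) :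
    Δ f i = (f i - ∑' j, p j * f j) * (1 - p i)⁻¹ := by
  have h := (ae_all G).1 (hΔ f) i
  have hs := (summ_L2 hp hanti hsum hG (Lp.memLp f)).hasSum
  have h1 := (hs.mul_left (p i)).sub (hasSum_ite_eq i (p i * p i * f i))
  have h2 : (fun j => p i * (p j * f j) - if j = i then p i * p i * f i else 0)
      = fun j => G.m i j * f j := by
    ext j
    rw [hG]
    by_cases h : i = j
    · subst h; simp; ring
    · simp [h, Ne.symm h]; ring
  rw [h2] at h1
  rw [h, h1.tsum_eq, deg_eq hsum hG]
  have hq := (q_pos hp hsum i).ne'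
  have hpi := (hp i).ne'
  field_simp
  ring

lemma lp_ext {f g : Lp ℝ 2 G.measure} : f = g ↔ ∀ i, f i = g i := by
  rw [Lp.ext_iff]
  exact ae_all G

lemma smul_app (x : ℝ) (f : Lp ℝ 2 G.measure) (i : ℕ) : (x • f) i = x * f i :=
  (ae_all G).1 (Lp.coeFn_smul x f) i

lemma toLp_app {f : ℕ → ℝ} (hf : MemLp f 2 G.measure) (i : ℕ) : hf.toLp f i = f i :=
  (ae_all G).1 hf.coeFn_toLp i

lemma eig_eq (hp : ∀ i, 0 < p i) (hanti : StrictAnti p) (hsum : HasSum p 1)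
    (hG : ∀ i j, G.m i j = if i = j then 0 else p i * p j)
    {Δ : Lp ℝ 2 G.measure →L[ℝ] Lp ℝ 2 G.measure} (hΔ : G.IsLaplacian Δ)
    (f : Lp ℝ 2 G.measure) (x : ℝ) :
    Δ f = x • f ↔ ∀ i, (1 - x * (1 - p i)) * f i = ∑' j, p j * f j := by
  rw [lp_ext]
  refine forall_congr' fun i => ?_
  rw [lap_apply hp hanti hsum hG hΔ, smul_app, ← div_eq_mul_inv, div_eq_iff (q_pos hp hsum i).ne']
  constructor <;> intro h <;> linarith

/-- eigenvectors have nonvanishing functional and x is not exceptional -/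
lemma eig_facts (hp : ∀ i, 0 < p i) (hanti : StrictAnti p) (hsum : HasSum p 1)
    (hG : ∀ i j, G.m i j = if i = j then 0 else p i * p j)
    {Δ : Lp ℝ 2 G.measure →L[ℝ] Lp ℝ 2 G.measure} (hΔ : G.IsLaplacian Δ)
    {f : Lp ℝ 2 G.measure} {x : ℝ} (hf : f ≠ 0) (h : Δ f = x • f) :
    x ≠ 1 ∧ (∀ i, 1 - x * (1 - p i) ≠ 0) ∧ ∑' j, p j * f j ≠ 0 := by
  rw [eig_eq hp hanti hsum hG hΔ] at h
  have hz : ∀ i, (0 : Lp ℝ 2 G.measure) i = 0 := fun i => (ae_all G).1 (Lp.coeFn_zero _ _ _) i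
  have key : ∀ k, 1 - x * (1 - p k) = 0 → False := by
    intro k hk
    have hS : ∑' j, p j * f j = 0 := by rw [← h k, hk, zero_mul]
    have hx0 : x ≠ 0 := by rintro rfl; norm_num at hk
    have h0 : ∀ i, i ≠ k → f i = 0 := by
      intro i hi
      have h1 := h i
      rw [hS] at h1
      rcases mul_eq_zero.1 h1 with h2 | h2
      · exfalso
        apply hi
        apply hanti.injective
        have : x * (p i - p k) = 0 := by linarith
        rcases mul_eq_zero.1 this with h3 | h3
        · exact absurd h3 hx0
        · linarith
      · exact h2
    have hk0 : f k = 0 := by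
      rw [tsum_eq_single k (fun i hi => by rw [h0 i hi, mul_zero])] at hS
      exact (mul_eq_zero.1 hS).resolve_left (hp k).ne'
    apply hf
    rw [lp_ext]
    intro i
    rw [hz]
    by_cases hi : i = k
    · rw [hi, hk0]
    · exact h0 i hi
  have hx1 : x ≠ 1 := by
    rintro rfl
    have h1 : ∀ i, p i * f i = ∑' j, p j * f j := by
      intro i; rw [← h i]; ring
    have hs := summ_L2 hp hanti hsum hG (Lp.memLp f)
    have h2 : ∑' j, p j * f j = 0 := by
      have := hs.tendsto_atTop_zero
      rw [show (fun i => p i * f i) = fun _ => ∑' j, p j * f j from funext h1] at this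
      exact tendsto_nhds_unique tendsto_const_nhds this
    apply hf
    rw [lp_ext]
    intro i
    rw [hz]
    have := h1 i
    rw [h2] at this
    exact (mul_eq_zero.1 this).resolve_left (hp i).ne'
  refine ⟨hx1, fun i => key i, fun hS => ?_⟩
  apply hf
  rw [lp_ext]
  intro i
  rw [hz]
  have := h i
  rw [hS] at this
  exact (mul_eq_zero.1 this).resolve_left (key i)

lemma eig_iff (hp : ∀ i, 0 < p i) (hanti : StrictAnti p) (hsum : HasSum p 1)
    (hG : ∀ i j, G.m i j = if i = j then 0 else p i * p j)
    {Δ : Lp ℝ 2 G.measure →L[ℝ] Lp ℝ 2 G.measure} (hΔ : G.IsLaplacian Δ) (x : ℝ) :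
    IsEigenvalue Δ x ↔ x ≠ 1 ∧ (∀ i, 1 - x * (1 - p i) ≠ 0) ∧ (x = 0 ∨ HH p x = 0) := by
  constructor
  · rintro ⟨f, hf, h⟩
    obtain ⟨h1, h2, h3⟩ := eig_facts hp hanti hsum hG hΔ hf h
    refine ⟨h1, h2, ?_⟩
    rw [eig_eq hp hanti hsum hG hΔ] at h
    have h4 : ∑' j, p j * f j = (1 + x * HH p x) * ∑' j, p j * f j := by
      rw [← F_eq hp hsum h1 h2, ← tsum_mul_right]
      congr 1
      ext i
      rw [← h i]
      have := h2 i
      rw [mul_assoc, inv_mul_cancel_left₀ this]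
    have h5 : x * HH p x * ∑' j, p j * f j = 0 := by linarith
    exact mul_eq_zero.1 ((mul_eq_zero.1 h5).resolve_right h3)
  · rintro ⟨h1, h2, h3⟩
    have := fin_meas hp hsum hG
    obtain ⟨C, hC⟩ := inv_bdd hsum h1
    have hm : MemLp (fun i => (1 - x * (1 - p i))⁻¹) 2 G.measure :=
      MemLp.of_bound (meas_any G _) C ((ae_all G).2 hC)
    refine ⟨hm.toLp _, ?_, ?_⟩
    · intro h0
      have hz : ∀ i, (0 : Lp ℝ 2 G.measure) i = 0 := fun i => (ae_all G).1 (Lp.coeFn_zero _ _ _) i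
      have := lp_ext.1 h0 0
      rw [toLp_app, hz] at this
      exact inv_ne_zero (h2 0) this
    · rw [eig_eq hp hanti hsum hG hΔ]
      intro i
      simp_rw [toLp_app]
      rw [F_eq hp hsum h1 h2, mul_inv_cancel₀ (h2 i)]
      rcases h3 with h3 | h3 <;> simp [h3]

lemma eig_simple (hp : ∀ i, 0 < p i) (hanti : StrictAnti p) (hsum : HasSum p 1)
    (hG : ∀ i j, G.m i j = if i = j then 0 else p i * p j)
    {Δ : Lp ℝ 2 G.measure →L[ℝ] Lp ℝ 2 G.measure} (hΔ : G.IsLaplacian Δ) (x : ℝ)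
    (f g : Lp ℝ 2 G.measure) (hf : Δ f = x • f) (hg : Δ g = x • g) (hf0 : f ≠ 0) :
    ∃ c : ℝ, g = c • f := by
  obtain ⟨h1, h2, h3⟩ := eig_facts hp hanti hsum hG hΔ hf0 hf
  rw [eig_eq hp hanti hsum hG hΔ] at hf hg
  refine ⟨(∑' j, p j * g j) / ∑' j, p j * f j, ?_⟩
  rw [lp_ext]
  intro i
  rw [smul_app]
  apply mul_left_cancel₀ (h2 i)
  rw [hg, mul_left_comm, hf, div_mul_cancel₀ _ h3]

lemma spec_eig (hp : ∀ i, 0 < p i) (hanti : StrictAnti p) (hsum : HasSum p 1)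
    (hG : ∀ i j, G.m i j = if i = j then 0 else p i * p j)
    {Δ : Lp ℝ 2 G.measure →L[ℝ] Lp ℝ 2 G.measure} (hΔ : G.IsLaplacian Δ) (x : ℝ)
    (hx : x ∈ spectrum ℝ Δ) (hx1 : x ≠ 1) : IsEigenvalue Δ x := by
  by_contra hne
  rw [spectrum.mem_iff] at hx
  apply hx
  rw [ContinuousLinearMap.isUnit_iff_bijective]
  have happ : ∀ f, (algebraMap ℝ (Lp ℝ 2 G.measure →L[ℝ] Lp ℝ 2 G.measure) x - Δ) f
      = x • f - Δ f := by
    intro f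
    simp [Algebra.algebraMap_eq_smul_one]
  constructor
  · rw [injective_iff_map_eq_zero]
    intro f hf
    by_contra hf0
    rw [happ, sub_eq_zero] at hf
    exact hne ⟨f, hf0, hf.symm⟩
  · intro g
    have := fin_meas hp hsum hG
    obtain ⟨C, hC⟩ := inv_bdd hsum hx1
    have hgm : MemLp (fun i => g i * (1 - p i)) 2 G.measure :=
      memLp_mul (Lp.memLp g) (C := 1) (fun i => by
        rw [abs_of_pos (q_pos hp hsum i)]; linarith [hp i])
    have hbase : ∀ s : ℝ, MemLp (fun i => (s - g i * (1 - p i)) * (1 - x * (1 - p i))⁻¹) 2 G.measure :=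
      fun s => memLp_mul ((memLp_const s).sub hgm) hC
    suffices hsuff : ∃ f : ℕ → ℝ, MemLp f 2 G.measure ∧
        ∀ i, (1 - x * (1 - p i)) * f i = (∑' j, p j * f j) - g i * (1 - p i) by
      obtain ⟨f, hfm, hf⟩ := hsuff
      refine ⟨hfm.toLp f, ?_⟩
      rw [happ, lp_ext]
      intro i
      have e : (x • hfm.toLp f - Δ (hfm.toLp f)) i = (x • hfm.toLp f) i - Δ (hfm.toLp f) i :=
        (ae_all G).1 (Lp.coeFn_sub _ _) i
      rw [e, smul_app, lap_apply hp hanti hsum hG hΔ]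
      simp_rw [toLp_app]
      have h1 := hf i
      have hq := (q_pos hp hsum i).ne'
      field_simp
      linarith
    by_cases hd : ∀ i, 1 - x * (1 - p i) ≠ 0
    · have hF : x * HH p x ≠ 0 := by
        intro h
        exact hne ((eig_iff hp hanti hsum hG hΔ x).2 ⟨hx1, hd, mul_eq_zero.1 h⟩)
      set B := ∑' j, p j * ((g j * (1 - p j)) * (1 - x * (1 - p j))⁻¹) with hB
      refine ⟨_, hbase (B / (x * HH p x)), fun i => ?_⟩
      have hsB := summ_L2 hp hanti hsum hG (memLp_mul hgm hC)
      have hsF := summ_inv hp hsum hx1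
      have e : ∑' j, p j * ((B / (x * HH p x) - g j * (1 - p j)) * (1 - x * (1 - p j))⁻¹)
          = B / (x * HH p x) := by
        have h1 := ((hsF.hasSum.mul_left (B / (x * HH p x))).sub hsB.hasSum).tsum_eq
        rw [F_eq hp hsum hx1 hd, ← hB] at h1
        have h2 : B / (x * HH p x) * (1 + x * HH p x) - B = B / (x * HH p x) := by
          rw [mul_add, div_mul_cancel₀ _ hF]; ring
        rw [h2] at h1
        refine Eq.trans ?_ h1
        congr 1
        ext j
        ring
      rw [e, mul_comm, inv_mul_cancel_right₀ (hd i)]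
    · push Not at hd
      obtain ⟨k, hk⟩ := hd
      have hx0 : x ≠ 0 := by rintro rfl; norm_num at hk
      set s := g k * (1 - p k) with hs
      set f0 : ℕ → ℝ := fun i => (s - g i * (1 - p i)) * (1 - x * (1 - p i))⁻¹ with hf0
      have hf0m : MemLp f0 2 G.measure := hbase s
      set c := (s - ∑' j, p j * f0 j) / p k with hc
      have h1m : MemLp (fun i => if i = k then c else 0) 2 G.measure :=
        MemLp.of_bound (meas_any G _) |c| ((ae_all G).2 fun i => by
          split_ifs
          · exact le_rfl
          · simp)
      refine ⟨_, hf0m.add h1m, fun i => ?_⟩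
      have hS : ∑' j, p j * (f0 + fun i => if i = k then c else 0) j = s := by
        have h1 := ((summ_L2 hp hanti hsum hG hf0m).hasSum.add
          (hasSum_ite_eq k (p k * c))).tsum_eq
        have h2 : p k * c = s - ∑' j, p j * f0 j := by
          rw [hc, mul_div_cancel₀ _ (hp k).ne']
        rw [h2] at h1
        rw [add_sub_cancel] at h1
        rw [← h1]
        congr 1
        ext j
        simp only [Pi.add_apply]
        by_cases h : j = k
        · subst h; simp [← h2]; ring
        · simp [h]
      rw [hS]
      simp only [Pi.add_apply]
      by_cases h : i = k
      · subst h
        rw [hk, hs]; ring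
      · have hd : 1 - x * (1 - p i) ≠ 0 := by
          intro h2
          apply h
          apply hanti.injective
          have : x * (p i - p k) = 0 := by linarith
          rcases mul_eq_zero.1 this with h3 | h3
          · exact absurd h3 hx0
          · linarith
        simp only [h, if_false, add_zero, hf0]
        rw [mul_comm, inv_mul_cancel_right₀ hd]

lemma eig_spec {H : Type*} [NormedAddCommGroup H] [NormedSpace ℝ H] [CompleteSpace H]
    {T : H →L[ℝ] H} {x : ℝ} (h : IsEigenvalue T x) : x ∈ spectrum ℝ T := by
  obtain ⟨f, hf, h⟩ := h
  rw [spectrum.mem_iff, ContinuousLinearMap.isUnit_iff_bijective]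
  intro hb
  apply hf
  apply hb.1
  rw [map_zero]
  simp [Algebra.algebraMap_eq_smul_one, h]

end graph

open SummableWeightedGraph in
/-- the spectrum of the normalised Laplacian of the infinite complete
graph with strictly decreasing weights. -/
theorem spectrum_laplacian_complete_graph (p : ℕ → ℝ) (hp : ∀ i, 0 < p i)
    (hanti : StrictAnti p) (hsum : HasSum p 1) (G : SummableWeightedGraph ℕ)
    (hG : ∀ i j, G.m i j = if i = j then 0 else p i * p j)
    (Δ : Lp ℝ 2 G.measure →L[ℝ] Lp ℝ 2 G.measure) (hΔ : G.IsLaplacian Δ) :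
    (1 : ℝ) ∈ spectrum ℝ Δ ∧
    (1 : ℝ) ∈ closure (spectrum ℝ Δ \ {1}) ∧
    ¬ IsEigenvalue Δ 1 ∧
    (∀ x ∈ spectrum ℝ Δ, x ≠ 1 → IsEigenvalue Δ x) ∧
    (∀ x ∈ spectrum ℝ Δ, x ≠ 1 → ∀ f g : Lp ℝ 2 G.measure,
      Δ f = x • f → Δ g = x • g → f ≠ 0 → ∃ c : ℝ, g = c • f) ∧
    IsEigenvalue Δ 0 ∧
    (∀ x : ℝ, IsEigenvalue Δ x → x ∈ Set.Ico (0 : ℝ) 1 → x = 0) ∧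
    (∀ x : ℝ, IsEigenvalue Δ x → x ≠ 0 → 1 < x ∧ x ≤ 2) ∧
    (∀ i : ℕ, ∃! x : ℝ,
      x ∈ Set.Ioo ((1 - p (i + 1))⁻¹) ((1 - p i)⁻¹) ∧ IsEigenvalue Δ x) ∧
    (∀ x : ℝ, IsEigenvalue Δ x → x ≠ 0 →
      ∃ i : ℕ, x ∈ Set.Ioo ((1 - p (i + 1))⁻¹) ((1 - p i)⁻¹)) ∧
    sInf {x : ℝ | x ∈ spectrum ℝ Δ ∧ 0 < x} = 1 ∧
    sSup (spectrum ℝ Δ) ∈ Set.Ioo ((1 - p 1)⁻¹) ((1 - p 0)⁻¹) ∧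
    IsEigenvalue Δ (sSup (spectrum ℝ Δ)) := by
  have EI := eig_iff hp hanti hsum hG hΔ
  have SE := spec_eig hp hanti hsum hG hΔ
  have ES : ∀ x, IsEigenvalue Δ x → x ∈ spectrum ℝ Δ := fun x hx => eig_spec hx
  have loc : ∀ x, IsEigenvalue Δ x → x ≠ 0 → (∃ k, x ∈ II p k) ∧ HH p x = 0 := by
    intro x hx h0
    obtain ⟨h1, h2, h3⟩ := (EI x).1 hx
    have h4 := h3.resolve_left h0
    exact ⟨HH_loc hp hanti hsum h1 h2 h4, h4⟩
  have gt : ∀ x, IsEigenvalue Δ x → x ≠ 0 → 1 < x := by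
    intro x hx h0
    obtain ⟨⟨k, hk⟩, _⟩ := loc x hx h0
    exact II_gt hp hsum hk
  have ex : ∀ k, ∃ x ∈ II p k, IsEigenvalue Δ x := by
    intro k
    obtain ⟨x, hx, h0⟩ := HH_zero hp hanti hsum k
    exact ⟨x, hx, (EI x).2 ⟨(II_gt hp hsum hx).ne', II_ne hp hanti hsum hx, Or.inr h0⟩⟩
  have uniq : ∀ k x y, x ∈ II p k → y ∈ II p k → IsEigenvalue Δ x → IsEigenvalue Δ y → x = y := by
    intro k x y hx hy ex ey
    have x1 := II_gt hp hsum hx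
    have y1 := II_gt hp hsum hy
    exact HH_uniq hp hanti hsum hx hy
      ((loc x ex (by linarith)).2.trans (loc y ey (by linarith)).2.symm)
  have acc : (1 : ℝ) ∈ closure (spectrum ℝ Δ \ {1}) := by
    choose μ hμ hμe using ex
    have hlim : Tendsto (fun k => (1 - p k)⁻¹) atTop (𝓝 1) := by
      have := (hsum.summable.tendsto_atTop_zero.const_sub 1).inv₀ (by norm_num)
      simpa using this
    have hμ1 : Tendsto μ atTop (𝓝 1) :=
      tendsto_of_tendsto_of_tendsto_of_le_of_le tendsto_const_nhds hlim
        (fun k => (II_gt hp hsum (hμ k)).le) (fun k => (hμ k).2.le)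
    refine mem_closure_of_tendsto hμ1 (Eventually.of_forall fun k => ⟨ES _ (hμe k), ?_⟩)
    exact (II_gt hp hsum (hμ k)).ne'
  have one : (1 : ℝ) ∈ spectrum ℝ Δ := by
    have := closure_mono Set.sdiff_subset acc
    rwa [(spectrum.isClosed Δ).closure_eq] at this
  obtain ⟨μ, hμ, hμe⟩ := ex 0
  have great : IsGreatest (spectrum ℝ Δ) μ := by
    refine ⟨ES _ hμe, fun x hx => ?_⟩
    have h1 := II_gt hp hsum hμ
    by_cases hx1 : x = 1
    · linarith
    by_cases hx0 : x = 0
    · linarith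
    have he := SE x hx hx1
    obtain ⟨⟨k, hk⟩, _⟩ := loc x he hx0
    rcases k with _ | k
    · exact (uniq 0 x μ hk hμ he hμe).le
    · have h2 : x < (1 - p (k+1))⁻¹ := hk.2
      have h3 : (1 - p (k+1))⁻¹ ≤ (1 - p (0+1))⁻¹ := by
        rw [inv_le_inv₀ (q_pos hp hsum _) (q_pos hp hsum _)]
        have : p (k+1) ≤ p (0+1) := hanti.antitone (by omega)
        linarith
      have h4 : (1 - p (0+1))⁻¹ < μ := hμ.1
      linarith
  have inf : IsLeast {x : ℝ | x ∈ spectrum ℝ Δ ∧ 0 < x} 1 := by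
    refine ⟨⟨one, one_pos⟩, ?_⟩
    rintro x ⟨hx, hx0⟩
    by_cases hx1 : x = 1
    · exact hx1.ge
    · exact (gt x (SE x hx hx1) hx0.ne').le
  refine ⟨one, acc, fun h => ((EI 1).1 h).1 rfl, SE, ?_, ?_, ?_, ?_, ?_, ?_, inf.csInf_eq, ?_, ?_⟩
  · intro x _ _ f g hf hg hf0
    exact eig_simple hp hanti hsum hG hΔ x f g hf hg hf0
  · exact (EI 0).2 ⟨by norm_num, by simp, Or.inl rfl⟩
  · intro x hx hI
    by_contra h0
    have := gt x hx h0
    have := hI.2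
    linarith
  · intro x hx h0
    obtain ⟨⟨k, hk⟩, hH⟩ := loc x hx h0
    exact ⟨gt x hx h0, HH_two hp hanti hsum hk hH⟩
  · intro k
    obtain ⟨x, hx, he⟩ := ex k
    exact ⟨x, ⟨hx, he⟩, fun y hy => uniq k y x hy.1 hx hy.2 he⟩
  · intro x hx h0
    exact (loc x hx h0).1
  · rw [great.csSup_eq]
    exact hμ
  · rw [great.csSup_eq]
    exact hμe
end
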